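/- arXiv:2003.09673 — 3 statements merged into one kernel-verified Lean document; each statement's English description precedes it below -/
import Mathlib

section
/- Let D, d, d_e be positive integers with d_e ≤ d ≤ D. Let U ∈ ℝ^{D×d_e} have orthonormal columns, let z* ∈ ℝ^{d_e} be nonzero, and set x_T* = U z* (so ‖x_T*‖₂ = ‖z*‖₂). For a D×d matrix A define y₂*(A) = Bᵀ (B Bᵀ)⁻¹ z* where B = Uᵀ A (defined for the almost-every A for which B Bᵀ is invertible, with an arbitrary value otherwise). Then the pushforward, under the map A ↦ ‖x_T*‖₂² / ‖y₂*(A)‖₂², of the Gaussian matrix measure on D×d matrices equals the chi-squared distribution with d − d_e + 1 degrees of freedom. -/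
open MeasureTheory ProbabilityTheory Matrix

noncomputable def gaussMatrix (D d : ℕ) : Measure (Fin D → Fin d → ℝ) :=
  Measure.pi fun _ : Fin D => Measure.pi fun _ : Fin d => gaussianReal 0 1

noncomputable def chiSq (n : ℕ) : Measure ℝ := gammaMeasure (n / 2) (1 / 2)

open WithLp Module
open scoped RealInnerProductSpace

theorem mgf_id_gammaMeasure_of_lt {a r t : ℝ} (ha : 0 < a) (hr : 0 < r) (ht : t < r) :
    mgf id (gammaMeasure a r) t = (r / (r - t)) ^ a := by
  have hrt : 0 < r - t := sub_pos.2 ht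
  have hmeas : Measurable (gammaPDF a r) := (measurable_gammaPDFReal a r).ennreal_ofReal
  rw [mgf, gammaMeasure, integral_withDensity_eq_integral_toReal_smul hmeas (by simp [gammaPDF])]
  have h : ∀ x : ℝ, (gammaPDF a r x).toReal • Real.exp (t * id x) =
      (Set.Ici 0).indicator (fun x ↦ r ^ a / Real.Gamma a *
        (x ^ (a - 1) * Real.exp (-((r - t) * x)))) x := by
    intro x
    by_cases hx : 0 ≤ x
    · rw [Set.indicator_of_mem (Set.mem_Ici.2 hx), gammaPDF,
        ENNReal.toReal_ofReal (gammaPDFReal_nonneg ha hr x), gammaPDFReal, if_pos hx, smul_eq_mul,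
        show -((r - t) * x) = -(r * x) + t * id x by simp; ring, Real.exp_add]
      ring
    · rw [Set.indicator_of_notMem (by simpa using hx), gammaPDF_of_neg (not_le.1 hx)]
      simp
  simp_rw [h]
  rw [integral_indicator measurableSet_Ici, integral_Ici_eq_integral_Ioi, integral_const_mul,
    Real.integral_rpow_mul_exp_neg_mul_Ioi ha hrt, Real.div_rpow hr.le hrt.le,
    Real.div_rpow zero_le_one hrt.le, Real.one_rpow]
  have := (Real.Gamma_pos_of_pos ha).ne'
  field_simp

theorem mgf_id_gammaMeasure_of_le {a r t : ℝ} (ha : 0 < a) (hr : 0 < r) (ht : r ≤ t) :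
    mgf id (gammaMeasure a r) t = 0 := by
  have hmeas : Measurable (gammaPDF a r) := (measurable_gammaPDFReal a r).ennreal_ofReal
  refine mgf_undef fun hint ↦ ?_
  rw [gammaMeasure, integrable_withDensity_iff_integrable_smul' hmeas (by simp [gammaPDF])] at hint
  have hC : 0 < r ^ a / Real.Gamma a := div_pos (Real.rpow_pos_of_pos hr a) (Real.Gamma_pos_of_pos ha)
  refine not_integrableOn_Ioi_rpow (a - 1) ?_
  refine Integrable.mono' ((hint.integrableOn (s := Set.Ioi 0)).const_mul (r ^ a / Real.Gamma a)⁻¹)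
    (by fun_prop) ?_
  refine (ae_restrict_iff' measurableSet_Ioi).2 (ae_of_all _ fun x (hx : 0 < x) ↦ ?_)
  rw [gammaPDF, ENNReal.toReal_ofReal (gammaPDFReal_nonneg ha hr x), gammaPDFReal, if_pos hx.le,
    smul_eq_mul, Real.norm_of_nonneg (by positivity)]
  have h1 : 1 ≤ Real.exp (-(r * x)) * Real.exp (t * id x) := by
    rw [← Real.exp_add]
    exact Real.one_le_exp (by simp only [id]; nlinarith)
  calc x ^ (a - 1) ≤ x ^ (a - 1) * (Real.exp (-(r * x)) * Real.exp (t * id x)) :=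
        le_mul_of_one_le_right (by positivity) h1
    _ = _ := by
      field_simp

theorem mgf_sq_gaussianReal (t : ℝ) :
    mgf (fun x ↦ x ^ 2) (gaussianReal 0 1) t = √(1 / (1 - 2 * t)) := by
  rw [mgf, integral_gaussianReal_eq_integral_smul one_ne_zero]
  have h : ∀ x : ℝ, gaussianPDFReal 0 1 x • Real.exp (t * x ^ 2) =
      (√(2 * Real.pi))⁻¹ * Real.exp (-(1 / 2 - t) * x ^ 2) := by
    intro x
    rw [gaussianPDFReal, smul_eq_mul, mul_assoc, ← Real.exp_add]
    simp only [sub_zero, NNReal.coe_one, mul_one]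
    congr 2
    ring
  simp_rw [h]
  rw [integral_const_mul, integral_gaussian, ← Real.sqrt_inv, ← Real.sqrt_mul (by positivity)]
  congr 1
  have := Real.pi_ne_zero
  rcases eq_or_ne (1 / 2 - t) 0 with h0 | h0
  · rw [h0, show 1 - 2 * t = 0 by linarith]; simp
  · have : 1 - 2 * t ≠ 0 := fun h ↦ h0 (by linarith)
    field_simp

theorem mgf_sum_sq_pi_gaussianReal (n : ℕ) (t : ℝ) :
    mgf (fun x : Fin n → ℝ ↦ ∑ i, x i ^ 2) (Measure.pi fun _ ↦ gaussianReal 0 1) t =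
      √(1 / (1 - 2 * t)) ^ n := by
  simp_rw [mgf, Finset.mul_sum, Real.exp_sum]
  rw [integral_fintype_prod_eq_pow (f := fun x : ℝ ↦ Real.exp (t * x ^ 2)), Fintype.card_fin,
    ← mgf_sq_gaussianReal, mgf]

theorem map_sum_sq_pi_gaussianReal {n : ℕ} (hn : 0 < n) :
    (Measure.pi fun _ : Fin n ↦ gaussianReal 0 1).map (fun x ↦ ∑ i, x i ^ 2) = chiSq n := by
  have ha : (0 : ℝ) < n / 2 := by positivity
  have : IsProbabilityMeasure (chiSq n) := isProbabilityMeasure_gammaMeasure ha (by norm_num)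
  have hmgf : mgf (fun x : Fin n → ℝ ↦ ∑ i, x i ^ 2) (Measure.pi fun _ ↦ gaussianReal 0 1) =
      mgf id (chiSq n) := by
    ext t
    rw [mgf_sum_sq_pi_gaussianReal, chiSq]
    rcases lt_or_ge t (1 / 2) with ht | ht
    · have h0 : 0 < 1 - 2 * t := by linarith
      rw [mgf_id_gammaMeasure_of_lt ha (by norm_num) ht, Real.sqrt_eq_rpow, ← Real.rpow_mul_natCast
        (by positivity)]
      congr 1
      · rw [div_eq_div_iff h0.ne' (by linarith)]; ring
      · ring
    · rw [mgf_id_gammaMeasure_of_le ha (by norm_num) ht, Real.sqrt_eq_zero_of_nonpos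
        (one_div_nonpos.2 (by linarith)), zero_pow hn.ne']
  have hmem : (0 : ℝ) ∈ interior (integrableExpSet
      (fun x : Fin n → ℝ ↦ ∑ i, x i ^ 2) (Measure.pi fun _ ↦ gaussianReal 0 1)) := by
    refine mem_interior.2 ⟨Set.Iio (1 / 2), fun t (ht : t < 1 / 2) ↦ ?_, isOpen_Iio, by simp⟩
    have h0 : 0 < 1 - 2 * t := by linarith
    refine mgf_pos_iff.1 ?_
    rw [mgf_sum_sq_pi_gaussianReal]
    positivity
  refine Measure.ext_of_charFun (funext fun t ↦ ?_)
  have h := eqOn_complexMGF_of_mgf hmgf (x := t * Complex.I) (by simpa using hmem)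
  rw [← complexMGF_mul_I (Measurable.aemeasurable (by fun_prop)), h, complexMGF_id_mul_I]

theorem map_norm_sq_stdGaussian {E : Type*} [NormedAddCommGroup E] [InnerProductSpace ℝ E]
    [FiniteDimensional ℝ E] [MeasurableSpace E] [BorelSpace E] (hE : 0 < finrank ℝ E) :
    (stdGaussian E).map (fun x ↦ ‖x‖ ^ 2) = chiSq (finrank ℝ E) := by
  rw [stdGaussian, Measure.map_map (by fun_prop) (by fun_prop), ← map_sum_sq_pi_gaussianReal hE]
  congr 1
  ext x
  rw [Function.comp_apply, ← real_inner_self_eq_norm_sq,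
    (stdOrthonormalBasis ℝ E).orthonormal.inner_sum]
  simp [sq]

theorem stdGaussian_map_of_inner_eq {E F : Type*} [NormedAddCommGroup E] [InnerProductSpace ℝ E]
    [FiniteDimensional ℝ E] [MeasurableSpace E] [BorelSpace E]
    [NormedAddCommGroup F] [InnerProductSpace ℝ F]
    [FiniteDimensional ℝ F] [MeasurableSpace F] [BorelSpace F]
    {f : E → F} {g : F → E} (hf : Measurable f) (hfg : ∀ x t, ⟪f x, t⟫ = ⟪x, g t⟫)
    (hg : ∀ t, ‖g t‖ = ‖t‖) : (stdGaussian E).map f = stdGaussian F := by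
  have := Measure.isProbabilityMeasure_map (μ := stdGaussian E) hf.aemeasurable
  refine Measure.ext_of_charFun (funext fun t ↦ ?_)
  rw [charFun_stdGaussian, ← hg, ← charFun_stdGaussian, charFun_apply, charFun_apply,
    integral_map hf.aemeasurable (Measurable.aestronglyMeasurable (by fun_prop))]
  simp_rw [hfg]

theorem map_norm_sq_orthogonalProjectionOnto_pi_gaussianReal {d : ℕ}
    (W : Submodule ℝ (EuclideanSpace ℝ (Fin d))) (hW : 0 < finrank ℝ W) :
    (Measure.pi fun _ : Fin d ↦ gaussianReal 0 1).map
      (fun x ↦ ‖W.orthogonalProjectionOnto (toLp 2 x)‖ ^ 2) = chiSq (finrank ℝ W) := by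
  have h : (stdGaussian (EuclideanSpace ℝ (Fin d))).map W.orthogonalProjectionOnto = stdGaussian W :=
    stdGaussian_map_of_inner_eq (g := fun w ↦ (w : EuclideanSpace ℝ (Fin d))) (by fun_prop)
      (fun x t ↦ W.inner_orthogonalProjectionOnto_eq_of_mem_right t x) (fun _ ↦ rfl)
  rw [← map_norm_sq_stdGaussian hW, ← h, ← map_pi_eq_stdGaussian,
    Measure.map_map (by fun_prop) (by fun_prop), Measure.map_map (by fun_prop) (by fun_prop)]
  rfl

theorem map_gaussMatrix_eq_stdGaussian (D d : ℕ) :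
    (gaussMatrix D d).map (fun A ↦ toLp 2 fun i ↦ toLp 2 (A i)) =
      stdGaussian (PiLp 2 fun _ : Fin D ↦ EuclideanSpace ℝ (Fin d)) := by
  have h : (gaussMatrix D d).map (fun A i ↦ toLp 2 (A i)) =
      Measure.pi fun _ : Fin D ↦ stdGaussian (EuclideanSpace ℝ (Fin d)) := by
    rw [gaussMatrix, Measure.pi_map_pi (fun _ ↦ by fun_prop)]
    simp_rw [map_pi_eq_stdGaussian]
  have h' : (gaussMatrix D d).map (fun A ↦ toLp 2 fun i ↦ toLp 2 (A i)) =
      (Measure.pi fun _ : Fin D ↦ stdGaussian (EuclideanSpace ℝ (Fin d))).map (toLp 2) := by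
    rw [← h, Measure.map_map (by fun_prop) (by fun_prop)]
    rfl
  rw [h']
  refine Measure.ext_of_charFun (funext fun t ↦ ?_)
  rw [charFun_stdGaussian, charFun_pi]
  simp_rw [charFun_stdGaussian, ← Complex.exp_sum, ← Complex.ofReal_pow]
  rw [PiLp.norm_sq_eq_of_L2]
  simp [Finset.sum_div, neg_div]

theorem gaussMatrix_eq_map_stdGaussian (D d : ℕ) :
    gaussMatrix D d = (stdGaussian (PiLp 2 fun _ : Fin D ↦ EuclideanSpace ℝ (Fin d))).map
      (fun x i j ↦ x i j) := by
  rw [← map_gaussMatrix_eq_stdGaussian, Measure.map_map (by fun_prop) (by fun_prop)]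
  exact Measure.map_id.symm

theorem gaussMatrix_map_transpose_mul {D m : ℕ} (d : ℕ) {V : Matrix (Fin D) (Fin m) ℝ}
    (hV : V.transpose * V = 1) :
    (gaussMatrix D d).map (fun A i j ↦ ∑ k, V k i * A k j) = gaussMatrix m d := by
  have h : (stdGaussian (PiLp 2 fun _ : Fin D ↦ EuclideanSpace ℝ (Fin d))).map
      (fun x ↦ toLp 2 fun i ↦ ∑ k, V k i • x k) =
      stdGaussian (PiLp 2 fun _ : Fin m ↦ EuclideanSpace ℝ (Fin d)) := by
    have hinner : ∀ (x : PiLp 2 fun _ : Fin D ↦ EuclideanSpace ℝ (Fin d))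
        (t : PiLp 2 fun _ : Fin m ↦ EuclideanSpace ℝ (Fin d)),
        ⟪(toLp 2 fun i ↦ ∑ k, V k i • x k : PiLp 2 fun _ : Fin m ↦ EuclideanSpace ℝ (Fin d)), t⟫ =
          ⟪x, toLp 2 fun k ↦ ∑ i, V k i • t i⟫ := by
      intro x t
      simp only [PiLp.inner_apply (𝕜 := ℝ) (f := fun _ ↦ EuclideanSpace ℝ (Fin d)), sum_inner,
        inner_sum, real_inner_smul_left, real_inner_smul_right]
      exact Finset.sum_comm
    refine stdGaussian_map_of_inner_eq (by fun_prop) hinner fun t ↦ ?_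
    rw [← sq_eq_sq₀ (norm_nonneg _) (norm_nonneg _), ← real_inner_self_eq_norm_sq, ← hinner,
      ← real_inner_self_eq_norm_sq]
    congr 2
    ext i j
    have hVij : ∀ i', ∑ k, V k i * V k i' = (1 : Matrix (Fin m) (Fin m) ℝ) i i' := fun i' ↦ by
      rw [← hV, Matrix.mul_apply]; rfl
    simp only [Finset.smul_sum, smul_smul]
    rw [Finset.sum_comm]
    simp_rw [← Finset.sum_smul, hVij, Matrix.one_apply]
    simp
  rw [gaussMatrix_eq_map_stdGaussian, gaussMatrix_eq_map_stdGaussian, ← h,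
    Measure.map_map (by fun_prop) (by fun_prop), Measure.map_map (by fun_prop) (by fun_prop)]
  congr 1
  ext x i j
  simp

theorem gaussMatrix_succ (m d : ℕ) :
    gaussMatrix (m + 1) d = ((gaussMatrix m d).prod (Measure.pi fun _ ↦ gaussianReal 0 1)).map
      (fun p ↦ Fin.cons p.2 p.1) := by
  have h := (measurePreserving_piFinSuccAbove (fun _ : Fin (m + 1) ↦
    Measure.pi fun _ : Fin d ↦ gaussianReal 0 1) 0).symm.map_eq
  rw [gaussMatrix, ← h, ← Measure.prod_swap, Measure.map_map (by fun_prop) (by fun_prop)]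
  congr 1
  exact funext fun p ↦ Fin.insertNth_zero' _ _

instance isProbabilityMeasure_gaussMatrix (D d : ℕ) : IsProbabilityMeasure (gaussMatrix D d) := by
  unfold gaussMatrix; infer_instance

theorem chiSq_singleton (n : ℕ) (x : ℝ) : chiSq n {x} = 0 :=
  withDensity_absolutelyContinuous _ _ (measure_singleton x)

theorem ae_notMem_of_finrank_lt {d : ℕ} (S : Submodule ℝ (EuclideanSpace ℝ (Fin d)))
    (hS : finrank ℝ S < d) :
    ∀ᵐ x ∂(Measure.pi fun _ : Fin d ↦ gaussianReal 0 1), toLp 2 x ∉ S := by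
  have hW : 0 < finrank ℝ Sᗮ := by
    have := S.finrank_add_finrank_orthogonal
    rw [finrank_euclideanSpace_fin] at this
    omega
  have h := chiSq_singleton (finrank ℝ Sᗮ) 0
  rw [← map_norm_sq_orthogonalProjectionOnto_pi_gaussianReal _ hW,
    Measure.map_apply (by fun_prop) (measurableSet_singleton 0)] at h
  refine measure_mono_null (fun x hx ↦ ?_) h
  have hx' : toLp 2 x ∈ S := by simpa using hx
  simp only [Set.mem_preimage, Set.mem_singleton_iff,
    Submodule.orthogonalProjectionOnto_orthogonal_apply_eq_zero hx', norm_zero]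
  norm_num

theorem gram_toLp {m d : ℕ} (C : Fin m → Fin d → ℝ) :
    gram ℝ (fun i ↦ toLp 2 (C i)) = of C * (of C).transpose := by
  ext i j
  simp [gram, Matrix.mul_apply, PiLp.inner_apply, mul_comm]

theorem det_mul_transpose_ne_zero_iff {m d : ℕ} (C : Fin m → Fin d → ℝ) :
    (of C * (of C).transpose).det ≠ 0 ↔ LinearIndependent ℝ (fun i ↦ toLp 2 (C i)) := by
  rw [← gram_toLp, det_gram_ne_zero_iff_linearIndependent]

theorem continuous_mul_transpose (m d : ℕ) :
    Continuous fun C : Fin m → Fin d → ℝ ↦ of C * (of C).transpose :=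
  have h : Continuous fun C : Fin m → Fin d → ℝ ↦ of C := continuous_id
  h.matrix_mul h.matrix_transpose

theorem measurableSet_linearIndependent (m d : ℕ) :
    MeasurableSet {C : Fin m → Fin d → ℝ | LinearIndependent ℝ (fun i ↦ toLp 2 (C i))} := by
  simp_rw [← det_mul_transpose_ne_zero_iff]
  exact (isOpen_ne_fun (continuous_mul_transpose m d).matrix_det continuous_const).measurableSet

theorem ae_linearIndependent_gaussMatrix {m d : ℕ} (h : m ≤ d) :
    ∀ᵐ C ∂gaussMatrix m d, LinearIndependent ℝ (fun i ↦ toLp 2 (C i)) := by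
  induction m with
  | zero => exact ae_of_all _ fun C ↦ linearIndependent_empty_type
  | succ m ih =>
    have hmeas : Measurable fun p : (Fin m → Fin d → ℝ) × (Fin d → ℝ) ↦
        (Fin.cons p.2 p.1 : Fin (m + 1) → Fin d → ℝ) := by fun_prop
    have hset := measurableSet_linearIndependent (m + 1) d
    rw [gaussMatrix_succ, ae_map_iff hmeas.aemeasurable hset]
    refine (Measure.ae_prod_iff_ae_ae (hmeas hset)).2 ?_
    filter_upwards [ih (by omega)] with y hy
    filter_upwards [ae_notMem_of_finrank_lt (Submodule.span ℝ (Set.range fun i ↦ toLp 2 (y i)))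
      (by rw [finrank_span_eq_card hy, Fintype.card_fin]; omega)] with x hx
    have hcons : (fun i ↦ toLp 2 ((Fin.cons x y : Fin (m + 1) → Fin d → ℝ) i)) =
        Fin.cons (toLp 2 x) fun i ↦ toLp 2 (y i) := by
      ext i : 1
      refine Fin.cases rfl (fun _ ↦ rfl) i
    rw [hcons, linearIndependent_finCons]
    exact ⟨hy, hx⟩

theorem one_div_norm_sq_eq_norm_sq_orthogonalProjectionOnto {E : Type*} [NormedAddCommGroup E]
    [InnerProductSpace ℝ E] (S : Submodule ℝ E) [S.HasOrthogonalProjection] {c y : E}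
    (hy : ∃ a : ℝ, ∃ z ∈ S, y = a • c + z) (hyS : y ∈ Sᗮ) (hc : ⟪c, y⟫ = 1) :
    1 / ‖y‖ ^ 2 = ‖Sᗮ.orthogonalProjectionOnto c‖ ^ 2 := by
  obtain ⟨a, z, hz, hyz⟩ := hy
  have hz0 : Sᗮ.orthogonalProjectionOnto z = 0 :=
    Submodule.orthogonalProjectionOnto_orthogonal_apply_eq_zero hz
  have hP : y = a • (Sᗮ.orthogonalProjectionOnto c : E) := by
    conv_lhs => rw [← Submodule.starProjection_eq_self_iff.2 hyS, Submodule.starProjection_apply,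
      hyz, map_add, hz0, add_zero, map_smul, Submodule.coe_smul]
  have hn : ‖y‖ ^ 2 = a ^ 2 * ‖Sᗮ.orthogonalProjectionOnto c‖ ^ 2 := by
    rw [hP, norm_smul, mul_pow, Real.norm_eq_abs, sq_abs, Submodule.coe_norm]
  have hin : a * ‖Sᗮ.orthogonalProjectionOnto c‖ ^ 2 = 1 := by
    rw [← hc, hP, real_inner_smul_right, ← real_inner_self_eq_norm_sq,
      Submodule.inner_orthogonalProjectionOnto_eq_of_mem_right]
  have hn0 : a ^ 2 * ‖Sᗮ.orthogonalProjectionOnto c‖ ^ 2 ≠ 0 := by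
    rw [sq, mul_assoc, hin, mul_one]
    rintro rfl
    simp at hin
  rw [hn, div_eq_iff hn0]
  linear_combination (-1 - a * ‖Sᗮ.orthogonalProjectionOnto c‖ ^ 2) * hin

/-- The minimum-norm solution of `C *ᵥ y = e₀`, for a matrix `C` of full row rank. -/
noncomputable def minNormSol {m d : ℕ} (C : Fin (m + 1) → Fin d → ℝ) : Fin d → ℝ :=
  ((of C).transpose * (of C * (of C).transpose)⁻¹) *ᵥ Pi.single 0 1

theorem measurable_minNormSol (m d : ℕ) :
    Measurable (minNormSol : (Fin (m + 1) → Fin d → ℝ) → Fin d → ℝ) := by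
  refine measurable_pi_lambda _ fun j ↦ ?_
  simp only [minNormSol, mulVec_single_one, col_apply, Matrix.mul_apply, Matrix.inv_def,
    Ring.inverse_eq_inv', Matrix.smul_apply, smul_eq_mul]
  have hdet := (continuous_mul_transpose (m + 1) d).matrix_det.measurable
  have hadj (i j) := ((continuous_mul_transpose (m + 1) d).matrix_adjugate.matrix_elem i j).measurable
  refine Finset.measurable_sum _ fun i _ ↦ Measurable.mul ?_ (hdet.inv.mul (hadj _ _))
  simp only [transpose_apply, of_apply]
  fun_prop

theorem one_div_sum_sq_minNormSol {m d : ℕ} {C : Fin (m + 1) → Fin d → ℝ}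
    (hC : LinearIndependent ℝ (fun i ↦ toLp 2 (C i))) :
    1 / ∑ j, minNormSol C j ^ 2 = ‖(Submodule.span ℝ (Set.range fun i : Fin m ↦
      toLp 2 (C i.succ)))ᗮ.orthogonalProjectionOnto (toLp 2 (C 0))‖ ^ 2 := by
  have hdet : IsUnit (of C * (of C).transpose).det :=
    isUnit_iff_ne_zero.2 ((det_mul_transpose_ne_zero_iff C).2 hC)
  have hsol : of C *ᵥ minNormSol C = Pi.single 0 1 := by
    rw [minNormSol, mulVec_mulVec, ← Matrix.mul_assoc, Matrix.mul_nonsing_inv _ hdet, one_mulVec]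
  have hinner (i : Fin (m + 1)) : ⟪toLp 2 (C i), toLp 2 (minNormSol C)⟫ =
      (Pi.single 0 1 : Fin (m + 1) → ℝ) i := by
    rw [← hsol]
    simp [PiLp.inner_apply, mulVec, dotProduct, mul_comm]
  rw [← one_div_norm_sq_eq_norm_sq_orthogonalProjectionOnto _ (y := toLp 2 (minNormSol C)) _ _
    (by rw [hinner, Pi.single_eq_same]), EuclideanSpace.real_norm_sq_eq]
  · set a := (of C * (of C).transpose)⁻¹ *ᵥ Pi.single 0 1 with ha
    refine ⟨a 0, ∑ i : Fin m, a i.succ • toLp 2 (C i.succ), Submodule.sum_mem _ fun i _ ↦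
      Submodule.smul_mem _ _ (Submodule.subset_span ⟨i, rfl⟩), ?_⟩
    rw [← Fin.sum_univ_succ (f := fun i ↦ a i • toLp 2 (C i)), minNormSol, ← mulVec_mulVec, ← ha]
    ext j
    simp [mulVec, dotProduct, mul_comm]
  · rw [Submodule.mem_orthogonal]
    intro u hu
    induction hu using Submodule.span_induction with
    | mem u hu => obtain ⟨i, rfl⟩ := hu; simp [hinner]
    | zero => simp
    | add u v _ _ hu hv => rw [inner_add_left, hu, hv, add_zero]
    | smul c u _ hu => rw [real_inner_smul_left, hu, mul_zero]

theorem map_one_div_sum_sq_minNormSol {m d : ℕ} (h : m + 1 ≤ d) :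
    (gaussMatrix (m + 1) d).map (fun C ↦ 1 / ∑ j, minNormSol C j ^ 2) = chiSq (d - m) := by
  have hsol := measurable_minNormSol m d
  have hmeas : Measurable fun C : Fin (m + 1) → Fin d → ℝ ↦ 1 / ∑ j, minNormSol C j ^ 2 := by
    fun_prop
  have hcons : Measurable fun p : (Fin m → Fin d → ℝ) × (Fin d → ℝ) ↦
      (Fin.cons p.2 p.1 : Fin (m + 1) → Fin d → ℝ) := by fun_prop
  have hli := ae_linearIndependent_gaussMatrix h
  rw [gaussMatrix_succ, ae_map_iff hcons.aemeasurable (measurableSet_linearIndependent _ _)] at hli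
  replace hli := Measure.ae_ae_of_ae_prod hli
  ext s hs
  rw [gaussMatrix_succ, Measure.map_map hmeas hcons, Measure.map_apply (hmeas.comp hcons) hs,
    Measure.prod_apply (hmeas.comp hcons hs)]
  have hslice : ∀ᵐ y ∂gaussMatrix m d, (Measure.pi fun _ : Fin d ↦ gaussianReal 0 1)
      (Prod.mk y ⁻¹' (((fun C ↦ 1 / ∑ j, minNormSol C j ^ 2) ∘
        fun p : (Fin m → Fin d → ℝ) × (Fin d → ℝ) ↦ Fin.cons p.2 p.1) ⁻¹' s)) =
        chiSq (d - m) s := by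
    filter_upwards [hli, ae_linearIndependent_gaussMatrix (Nat.le_of_succ_le h)] with y hy hym
    set S := Submodule.span ℝ (Set.range fun i ↦ toLp 2 (y i)) with hS
    have hfin : finrank ℝ Sᗮ = d - m := by
      have h1 := S.finrank_add_finrank_orthogonal
      have h2 := finrank_span_eq_card hym
      rw [finrank_euclideanSpace_fin] at h1
      rw [← hS, Fintype.card_fin] at h2
      omega
    rw [← hfin, ← map_norm_sq_orthogonalProjectionOnto_pi_gaussianReal Sᗮ (hfin ▸ Nat.sub_pos_of_lt h),
      Measure.map_apply (by fun_prop) hs]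
    refine measure_congr ?_
    filter_upwards [hy] with x hx
    exact congrArg (· ∈ s) (one_div_sum_sq_minNormSol hx)
  rw [lintegral_congr_ae hslice]
  simp

theorem exists_orthogonal_mulVec_single {n : ℕ} {z : Fin (n + 1) → ℝ} (hz : z ≠ 0) :
    ∃ (Q : Matrix (Fin (n + 1)) (Fin (n + 1)) ℝ) (r : ℝ), r ≠ 0 ∧ Q.transpose * Q = 1 ∧
      Q *ᵥ (r • Pi.single 0 1) = z := by
  set w : EuclideanSpace ℝ (Fin (n + 1)) := toLp 2 z with hw
  have hw0 : ‖w‖ ≠ 0 := by simpa [hw] using hz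
  have hunit : ‖‖w‖⁻¹ • w‖ = 1 := by
    rw [norm_smul, norm_inv, norm_norm, inv_mul_cancel₀ hw0]
  obtain ⟨b, hb⟩ := Orthonormal.exists_orthonormalBasis_extension_of_card_eq (𝕜 := ℝ)
    (ι := Fin (n + 1)) (v := fun _ ↦ ‖w‖⁻¹ • w) (s := {0}) (by simp)
    ⟨fun _ ↦ hunit, fun i j hij ↦ (hij (Subsingleton.elim i j)).elim⟩
  refine ⟨of fun i j ↦ b j i, ‖w‖, hw0, ?_, ?_⟩
  · ext i j
    have := orthonormal_iff_ite.1 b.orthonormal i j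
    simpa [PiLp.inner_apply, Matrix.mul_apply, mul_comm, Matrix.one_apply] using this
  · ext i
    rw [mulVec_smul, mulVec_single_one]
    simpa [hb 0 rfl, hw] using mul_inv_cancel_left₀ hw0 (z i)

theorem stmt4 (D d de : ℕ) (hD : 0 < D) (hd : 0 < d) (hde : 0 < de)
    (h1 : de ≤ d) (h2 : d ≤ D)
    (U : Matrix (Fin D) (Fin de) ℝ) (hU : U.transpose * U = 1)
    (zstar : Fin de → ℝ) (hz : zstar ≠ 0)
    (y2 : (Fin D → Fin d → ℝ) → (Fin d → ℝ))
    (hy2 : ∀ A : Fin D → Fin d → ℝ,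
      IsUnit ((U.transpose * Matrix.of A) * (U.transpose * Matrix.of A).transpose) →
      y2 A = ((U.transpose * Matrix.of A).transpose *
        ((U.transpose * Matrix.of A) * (U.transpose * Matrix.of A).transpose)⁻¹).mulVec zstar) :
    Measure.map
        (fun A => (∑ i, (U.mulVec zstar) i ^ 2) / (∑ i, (y2 A) i ^ 2))
        (gaussMatrix D d)
      = chiSq (d - de + 1) := by
  obtain ⟨m, rfl⟩ : ∃ m, de = m + 1 := ⟨de - 1, by omega⟩
  obtain ⟨Q, r, hr, hQ, hQz⟩ := exists_orthogonal_mulVec_single hz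
  have hQ' : Q * Q.transpose = 1 := mul_eq_one_comm.1 hQ
  have hV : (U * Q).transpose * (U * Q) = 1 := by
    rw [transpose_mul, Matrix.mul_assoc, ← Matrix.mul_assoc U.transpose, hU, Matrix.one_mul, hQ]
  have hT : Measurable fun (A : Fin D → Fin d → ℝ) (i : Fin (m + 1)) (j : Fin d) ↦
      ∑ k, (U * Q) k i * A k j := by fun_prop
  have hsol := measurable_minNormSol m d
  have hsumU : ∑ i, (U.mulVec zstar) i ^ 2 = r ^ 2 := by
    have h : ∑ i, (U.mulVec zstar) i ^ 2 = (U *ᵥ zstar) ⬝ᵥ (U *ᵥ zstar) := by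
      simp [dotProduct, sq]
    rw [h, ← hQz, mulVec_mulVec, dotProduct_mulVec, vecMul_mulVec, hV, vecMul_one]
    simp [sq]
  have hae : ∀ᵐ A ∂gaussMatrix D d,
      (∑ i, (U.mulVec zstar) i ^ 2) / (∑ i, (y2 A) i ^ 2) =
        1 / ∑ j, minNormSol (fun i j ↦ ∑ k, (U * Q) k i * A k j) j ^ 2 := by
    have hli := ae_linearIndependent_gaussMatrix h1
    rw [← gaussMatrix_map_transpose_mul d hV,
      ae_map_iff hT.aemeasurable (measurableSet_linearIndependent _ _)] at hli
    filter_upwards [hli] with A hA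
    rw [← det_mul_transpose_ne_zero_iff] at hA
    set C : Fin (m + 1) → Fin d → ℝ := fun i j ↦ ∑ k, (U * Q) k i * A k j with hC
    have hdet := isUnit_iff_ne_zero.2 hA
    have hUA : U.transpose * of A = Q * of C := by
      have : of C = (U * Q).transpose * of A := rfl
      rw [this, transpose_mul, Matrix.mul_assoc, ← Matrix.mul_assoc, hQ', Matrix.one_mul]
    have hinv : (Q * of C * (Q * of C).transpose) *
        (Q * (of C * (of C).transpose)⁻¹ * Q.transpose) = 1 := by
      calc _ = Q * (of C * (of C).transpose * (Q.transpose * Q) *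
            (of C * (of C).transpose)⁻¹) * Q.transpose := by
            simp only [transpose_mul, Matrix.mul_assoc]
        _ = 1 := by rw [hQ, Matrix.mul_one, Matrix.mul_nonsing_inv _ hdet, Matrix.mul_one, hQ']
    have hy : y2 A = r • minNormSol C := by
      rw [hy2 A (by rw [hUA]; exact IsUnit.of_mul_eq_one _ hinv), hUA,
        Matrix.inv_eq_right_inv hinv, ← hQz, mulVec_mulVec, mulVec_smul, minNormSol]
      congr 2
      calc _ = (of C).transpose * (Q.transpose * Q) * (of C * (of C).transpose)⁻¹ *
            (Q.transpose * Q) := by simp only [transpose_mul, Matrix.mul_assoc]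
        _ = _ := by rw [hQ, Matrix.mul_one, Matrix.mul_one]
    rw [hsumU, hy]
    simp only [Pi.smul_apply, smul_eq_mul, mul_pow, ← Finset.mul_sum]
    rw [div_mul_eq_div_div, div_self (pow_ne_zero 2 hr)]
  rw [Measure.map_congr hae, show d - (m + 1) + 1 = d - m by omega,
    ← map_one_div_sum_sq_minNormSol h1, ← gaussMatrix_map_transpose_mul d hV,
    Measure.map_map (by fun_prop) hT]
  rfl
end

section
/- Let D, d, d_e be positive integers with d_e ≤ d ≤ D. Let f : ℝ^D → ℝ be continuous with effective subspace spanned by the columns of a matrix U ∈ ℝ^{D×d_e} with orthonormal columns, i.e. f(x) = f(U Uᵀ x) for all x. Assume f attains a global minimum f* and let G = {x ∈ ℝ^D : f(x) = f*} (nonempty). Let μ* = inf{‖x‖₂ : x ∈ G}. Then for every δ > 0, the Gaussian-matrix-measure of the set {A : ∃ y ∈ ℝ^d with ‖y‖_∞ ≤ δ and f(A y) = f*} is at least the probability that a chi-squared random variable with d − d_e + 1 degrees of freedom is at least (μ*)²/δ². -/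
open MeasureTheory ProbabilityTheory Matrix

lemma stdGaussian_eq_withDensity (E : Type*) [NormedAddCommGroup E] [InnerProductSpace ℝ E]
    [FiniteDimensional ℝ E] [MeasurableSpace E] [BorelSpace E] :
    stdGaussian E = volume.withDensity fun x : E => ENNReal.ofReal
      (((2 * Real.pi) ^ ((Module.finrank ℝ E : ℝ) / 2))⁻¹ * Real.exp (-‖x‖ ^ 2 / 2)) := by
  have hint : Integrable fun x : E =>
      ((2 * Real.pi) ^ ((Module.finrank ℝ E : ℝ) / 2))⁻¹ * Real.exp (-‖x‖ ^ 2 / 2) := by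
    refine Integrable.const_mul ?_ _
    have h := (GaussianFourier.integrable_cexp_neg_mul_sq_norm_add (V := E) (b := 1 / 2)
      (by norm_num) 0 0).norm
    refine h.congr (ae_of_all _ fun x => ?_)
    simp only [Complex.norm_exp]
    congr 1
    norm_num
    norm_cast
    ring
  have := isFiniteMeasure_withDensity_ofReal hint.2
  refine Measure.ext_of_charFun ?_
  ext t
  rw [charFun_stdGaussian, charFun_apply, integral_withDensity_eq_integral_toReal_smul
    (by fun_prop) (by simp)]
  have h := GaussianFourier.integral_cexp_neg_mul_sq_norm_add (V := E) (b := 1 / 2)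
    (by norm_num) Complex.I t
  have hpos : (0 : ℝ) < (2 * Real.pi) ^ ((Module.finrank ℝ E : ℝ) / 2) := by positivity
  have hC : ((Real.pi : ℂ) / (1 / 2)) ^ ((Module.finrank ℝ E : ℂ) / 2)
      = (((2 * Real.pi) ^ ((Module.finrank ℝ E : ℝ) / 2) : ℝ) : ℂ) := by
    rw [Complex.ofReal_cpow (by positivity)]
    push_cast
    congr 1
    ring
  rw [hC] at h
  have hsm : ∀ x : E, (ENNReal.ofReal (((2 * Real.pi) ^ ((Module.finrank ℝ E : ℝ) / 2))⁻¹ *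
      Real.exp (-‖x‖ ^ 2 / 2))).toReal • Complex.exp (inner ℝ x t * Complex.I)
      = (((2 * Real.pi) ^ ((Module.finrank ℝ E : ℝ) / 2) : ℝ) : ℂ)⁻¹ *
        Complex.exp (-(1 / 2) * (‖x‖ : ℂ) ^ 2 + Complex.I * inner ℝ t x) := by
    intro x
    rw [ENNReal.toReal_ofReal (by positivity), Complex.real_smul, Complex.exp_add,
      real_inner_comm]
    push_cast
    rw [mul_assoc]
    congr 3
    · ring_nf
    · ring_nf
  simp_rw [hsm]
  rw [integral_const_mul, h, ← mul_assoc, inv_mul_cancel₀ (by exact_mod_cast hpos.ne'), one_mul]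
  congr 1
  rw [Complex.I_sq]
  ring

lemma integral_sq_norm_stdGaussian_eq (E : Type*) [NormedAddCommGroup E] [InnerProductSpace ℝ E]
    [FiniteDimensional ℝ E] [MeasurableSpace E] [BorelSpace E] [Nontrivial E] :
    ∃ C : ℝ, ∀ g : ℝ → ℝ, ∫ x, g (‖x‖ ^ 2) ∂(stdGaussian E)
      = C * ∫ t, g t ∂(chiSq (Module.finrank ℝ E)) := by
  set k := Module.finrank ℝ E with hk
  have hk0 : 0 < k := Module.finrank_pos
  have ha : (0 : ℝ) < k / 2 := by positivity
  obtain ⟨c, hc⟩ : ∃ c : ℝ, ∀ t : ℝ, 0 < t →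
      gammaPDFReal (k / 2) (1 / 2) t = c * (t ^ ((k : ℝ) / 2 - 1) * Real.exp (-t / 2)) ∧ c ≠ 0 := by
    refine ⟨(1 / 2) ^ ((k : ℝ) / 2) / Real.Gamma (k / 2), fun t ht => ⟨?_, ?_⟩⟩
    · rw [gammaPDFReal, if_pos ht.le, mul_assoc]
      congr 3
      ring
    · have := Real.Gamma_pos_of_pos ha
      positivity
  have hc0 : c ≠ 0 := (hc 1 one_pos).2
  refine ⟨((2 * Real.pi) ^ ((k : ℝ) / 2))⁻¹ * (k * (volume : Measure E).real (Metric.ball 0 1)) *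
    (1 / 2) * c⁻¹, fun g => ?_⟩
  have h1 : ∫ x, g (‖x‖ ^ 2) ∂(stdGaussian E) = ((2 * Real.pi) ^ ((k : ℝ) / 2))⁻¹ *
      ∫ x : E, Real.exp (-‖x‖ ^ 2 / 2) * g (‖x‖ ^ 2) := by
    rw [stdGaussian_eq_withDensity, integral_withDensity_eq_integral_toReal_smul
      (by fun_prop) (by simp), ← integral_const_mul]
    refine integral_congr_ae (ae_of_all _ fun x => ?_)
    simp only
    rw [ENNReal.toReal_ofReal (by positivity), smul_eq_mul, mul_assoc]
  have h2 := integral_fun_norm_addHaar (volume : Measure E)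
    (fun y => Real.exp (-y ^ 2 / 2) * g (y ^ 2))
  have h3 : ∫ y in Set.Ioi (0 : ℝ), y ^ (k - 1) • (Real.exp (-y ^ 2 / 2) * g (y ^ 2))
      = (1 / 2) * ∫ t in Set.Ioi (0 : ℝ), t ^ ((k : ℝ) / 2 - 1) * Real.exp (-t / 2) * g t := by
    rw [← integral_comp_rpow_Ioi_of_pos
      (g := fun t => t ^ ((k : ℝ) / 2 - 1) * Real.exp (-t / 2) * g t) (p := 2) (by norm_num),
      ← integral_const_mul]
    refine setIntegral_congr_fun measurableSet_Ioi fun y (hy : 0 < y) => ?_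
    simp only [smul_eq_mul]
    have e1 : y ^ (k - 1) = y * (y ^ (2 : ℝ)) ^ ((k : ℝ) / 2 - 1) := by
      rw [← Real.rpow_mul hy.le, ← Real.rpow_natCast, Nat.cast_sub hk0]
      nth_rw 2 [← Real.rpow_one y]
      rw [← Real.rpow_add hy]
      congr 1
      push_cast
      ring
    rw [e1, Real.rpow_two]
    norm_num
    ring
  have h4 : ∫ t, g t ∂(chiSq k)
      = c * ∫ t in Set.Ioi (0 : ℝ), t ^ ((k : ℝ) / 2 - 1) * Real.exp (-t / 2) * g t := by
    rw [chiSq, gammaMeasure, integral_withDensity_eq_integral_toReal_smul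
      (f := gammaPDF (k / 2) (1 / 2)) (measurable_gammaPDFReal _ _).ennreal_ofReal
      (ae_of_all _ fun x => ENNReal.ofReal_lt_top), ← integral_const_mul,
      ← setIntegral_eq_integral_of_forall_compl_eq_zero (s := Set.Ici 0),
      integral_Ici_eq_integral_Ioi]
    · refine setIntegral_congr_fun measurableSet_Ioi fun t (ht : 0 < t) => ?_
      simp only [gammaPDF]
      rw [ENNReal.toReal_ofReal (gammaPDFReal_nonneg ha (by norm_num) t), (hc t ht).1, smul_eq_mul]
      ring
    · intro t ht
      rw [gammaPDF_of_neg (not_le.mp ht)]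
      simp
  rw [h1, h2, h3, h4, ← hk]
  simp only [nsmul_eq_mul, smul_eq_mul]
  field_simp

lemma map_sq_norm_stdGaussian (E : Type*) [NormedAddCommGroup E] [InnerProductSpace ℝ E]
    [FiniteDimensional ℝ E] [MeasurableSpace E] [BorelSpace E] [Nontrivial E] :
    (stdGaussian E).map (fun x => ‖x‖ ^ 2) = chiSq (Module.finrank ℝ E) := by
  have hk0 : 0 < Module.finrank ℝ E := Module.finrank_pos
  have : IsProbabilityMeasure (chiSq (Module.finrank ℝ E)) :=
    isProbabilityMeasure_gammaMeasure (by positivity) (by norm_num)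
  have hm : Measurable fun x : E => ‖x‖ ^ 2 := by fun_prop
  have := Measure.isProbabilityMeasure_map (μ := stdGaussian E) hm.aemeasurable
  obtain ⟨C, hC⟩ := integral_sq_norm_stdGaussian_eq E
  have hC1 : C = 1 := by simpa using (hC fun _ => 1).symm
  refine Measure.ext fun s hs => ?_
  rw [← measureReal_eq_measureReal_iff, ← integral_indicator_one hs, ← integral_indicator_one hs,
    integral_map hm.aemeasurable (by fun_prop (disch := assumption)), hC, hC1, one_mul]

lemma map_orthogonalProjectionOnto_stdGaussian {E : Type*} [NormedAddCommGroup E]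
    [InnerProductSpace ℝ E] [FiniteDimensional ℝ E] [MeasurableSpace E] [BorelSpace E]
    (K : Submodule ℝ E) :
    (stdGaussian E).map K.orthogonalProjectionOnto = stdGaussian K := by
  have hm : Measurable K.orthogonalProjectionOnto :=
    K.orthogonalProjectionOnto.continuous.measurable
  have := Measure.isProbabilityMeasure_map (μ := stdGaussian E) hm.aemeasurable
  refine Measure.ext_of_charFun ?_
  ext t
  rw [charFun_apply, integral_map hm.aemeasurable (by fun_prop)]
  simp_rw [Submodule.inner_orthogonalProjectionOnto_eq_of_mem_right]
  rw [← charFun_apply, charFun_stdGaussian, charFun_stdGaussian, Submodule.coe_norm]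

lemma stdGaussian_setOf_le_sq_norm_orthogonalProjectionOnto {E : Type*} [NormedAddCommGroup E]
    [InnerProductSpace ℝ E] [FiniteDimensional ℝ E] [MeasurableSpace E] [BorelSpace E]
    (K : Submodule ℝ E) (hK : 0 < Module.finrank ℝ K) (c : ℝ) :
    stdGaussian E {x | c ≤ ‖K.orthogonalProjectionOnto x‖ ^ 2}
      = chiSq (Module.finrank ℝ K) {t | c ≤ t} := by
  have : Nontrivial K := Module.nontrivial_of_finrank_pos hK
  have hm : Measurable K.orthogonalProjectionOnto :=
    K.orthogonalProjectionOnto.continuous.measurable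
  rw [← map_sq_norm_stdGaussian K, ← map_orthogonalProjectionOnto_stdGaussian K,
    Measure.map_map (by fun_prop) hm, Measure.map_apply (by fun_prop)
      (show MeasurableSet {t : ℝ | c ≤ t} from measurableSet_Ici)]
  rfl

lemma Submodule.exists_le_finrank_eq {E : Type*} [AddCommGroup E] [Module ℝ E]
    [FiniteDimensional ℝ E] (K : Submodule ℝ E) {k : ℕ} (hk : k ≤ Module.finrank ℝ K) :
    ∃ L ≤ K, Module.finrank ℝ L = k := by
  let b := Module.finBasis ℝ K
  let v : Fin k → E := fun i => b (Fin.castLE hk i)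
  have hv : LinearIndependent ℝ v :=
    (b.linearIndependent.map' K.subtype K.ker_subtype).comp _ (Fin.castLE_injective hk)
  refine ⟨Submodule.span ℝ (Set.range v), Submodule.span_le.2 ?_, ?_⟩
  · rintro _ ⟨i, rfl⟩
    exact (b _).2
  · rw [finrank_span_eq_card hv, Fintype.card_fin]

lemma measurePreserving_pi_transpose {ι κ : Type*} [Fintype ι] [Fintype κ] (μ : Measure ℝ)
    [IsProbabilityMeasure μ] :
    MeasurePreserving (fun (A : ι → κ → ℝ) j i => A i j)
      (Measure.pi fun _ => Measure.pi fun _ => μ) (Measure.pi fun _ => Measure.pi fun _ => μ) := by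
  have hm : Measurable fun (A : ι → κ → ℝ) j i => A i j := by fun_prop
  have hm2 : Measurable fun (B : κ → ι → ℝ) (p : ι × κ) => B p.2 p.1 := by fun_prop
  have hm1 : Measurable fun (A : ι → κ → ℝ) (p : ι × κ) => A p.1 p.2 := by fun_prop
  have h1 : (Measure.pi fun _ : ι × κ => μ) = (Measure.pi fun _ : ι => Measure.pi fun _ : κ => μ).map
      (fun A p => A p.1 p.2) := by
    refine Measure.pi_eq fun s hs => ?_
    rw [Measure.map_apply hm1 (.univ_pi hs)]
    have : (fun (A : ι → κ → ℝ) (p : ι × κ) => A p.1 p.2) ⁻¹' (Set.univ.pi s)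
        = Set.univ.pi fun i => Set.univ.pi fun j => s (i, j) := by
      ext A; simp [Set.mem_pi]
    rw [this, Measure.pi_pi]
    simp_rw [Measure.pi_pi]
    rw [Fintype.prod_prod_type]
  have h2 : (Measure.pi fun _ : ι × κ => μ) = (Measure.pi fun _ : κ => Measure.pi fun _ : ι => μ).map
      (fun B p => B p.2 p.1) := by
    refine Measure.pi_eq fun s hs => ?_
    rw [Measure.map_apply hm2 (.univ_pi hs)]
    have : (fun (B : κ → ι → ℝ) (p : ι × κ) => B p.2 p.1) ⁻¹' (Set.univ.pi s)
        = Set.univ.pi fun j => Set.univ.pi fun i => s (i, j) := by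
      ext A; simp only [Set.mem_preimage, Set.mem_pi, Set.mem_univ, true_imp_iff, Prod.forall]
      exact forall_comm
    rw [this, Measure.pi_pi]
    simp_rw [Measure.pi_pi]
    rw [Fintype.prod_prod_type_right]
  refine ⟨hm, ?_⟩
  have hm3 : Measurable fun (C : ι × κ → ℝ) j i => C (i, j) := by fun_prop
  have h3 := congrArg (Measure.map fun (C : ι × κ → ℝ) j i => C (i, j)) (h1.symm.trans h2)
  rw [Measure.map_map hm3 hm1, Measure.map_map hm3 hm2] at h3
  exact h3.trans Measure.map_id

lemma measurePreserving_orthonormalBasis_pi_gaussianReal {ι : Type*} [Fintype ι]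
    (b : OrthonormalBasis ι ℝ (EuclideanSpace ℝ ι)) :
    MeasurePreserving (fun (x : ι → ℝ) i => ∑ k, x k * b k i)
      (Measure.pi fun _ => gaussianReal 0 1) (Measure.pi fun _ => gaussianReal 0 1) := by
  refine ⟨by fun_prop, ?_⟩
  have h := congrArg (Measure.map (WithLp.ofLp (p := 2) (V := ι → ℝ)))
    ((stdGaussian_eq_map_pi_orthonormalBasis b).symm.trans map_pi_eq_stdGaussian.symm)
  rw [Measure.map_map (by fun_prop) (Finset.measurable_sum _ (by fun_prop)),
    Measure.map_map (by fun_prop) (by fun_prop)] at h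
  refine Eq.trans (congrArg (fun g => Measure.map g _) ?_) (h.trans Measure.map_id)
  ext x i
  simp

lemma measurePreserving_orthonormalBasis_gaussMatrix {D : ℕ} (d : ℕ)
    (b : OrthonormalBasis (Fin D) ℝ (EuclideanSpace ℝ (Fin D))) :
    MeasurePreserving (fun (A : Fin D → Fin d → ℝ) i j => ∑ k, A k j * b k i)
      (gaussMatrix D d) (gaussMatrix D d) :=
  (measurePreserving_pi_transpose (gaussianReal 0 1)).comp
    ((measurePreserving_pi (fun _ : Fin d => Measure.pi fun _ : Fin D => gaussianReal 0 1) _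
      fun _ => measurePreserving_orthonormalBasis_pi_gaussianReal b).comp
      (measurePreserving_pi_transpose (gaussianReal 0 1)))

lemma le_gaussMatrix_of_forall_section {n d k : ℕ} (hk : 0 < k) (c : ℝ)
    {S : Set (Fin (n + 1) → Fin d → ℝ)} (hS : MeasurableSet S)
    (h : ∀ R : Fin n → Fin d → ℝ, ∃ K : Submodule ℝ (EuclideanSpace ℝ (Fin d)),
      Module.finrank ℝ K = k ∧ ∀ x : EuclideanSpace ℝ (Fin d),
        c ≤ ‖K.orthogonalProjectionOnto x‖ ^ 2 → Fin.cons x.ofLp R ∈ S) :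
    chiSq k {t | c ≤ t} ≤ gaussMatrix (n + 1) d S := by
  have hmp := (measurePreserving_piFinSuccAbove
    (fun _ : Fin (n + 1) => Measure.pi fun _ : Fin d => gaussianReal 0 1) 0).symm
  rw [gaussMatrix, ← hmp.measure_preimage hS.nullMeasurableSet,
    Measure.prod_apply_symm (hmp.measurable hS)]
  have hle : ∀ R : Fin n → Fin d → ℝ, chiSq k {t | c ≤ t} ≤
      (Measure.pi fun _ : Fin d => gaussianReal 0 1) ((fun x => (x, R)) ⁻¹'
        ((MeasurableEquiv.piFinSuccAbove (fun _ : Fin (n + 1) => Fin d → ℝ) 0).symm ⁻¹' S)) := by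
    intro R
    obtain ⟨K, rfl, hK⟩ := h R
    have hms : MeasurableSet {x | c ≤ ‖K.orthogonalProjectionOnto x‖ ^ 2} :=
      measurableSet_le measurable_const
        (K.orthogonalProjectionOnto.continuous.norm.pow 2).measurable
    rw [← stdGaussian_setOf_le_sq_norm_orthogonalProjectionOnto K hk, ← map_pi_eq_stdGaussian,
      Measure.map_apply (by fun_prop) hms]
    refine measure_mono fun x hx => ?_
    simpa [Fin.consEquiv] using hK _ hx
  calc chiSq k {t | c ≤ t}
      = ∫⁻ _ : Fin n → Fin d → ℝ, chiSq k {t | c ≤ t}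
          ∂(Measure.pi fun _ => Measure.pi fun _ => gaussianReal 0 1) := by simp
    _ ≤ _ := lintegral_mono hle

lemma isClosed_setOf_exists_box {D d : ℕ} {f : (Fin D → ℝ) → ℝ} (hf : Continuous f)
    (δ a : ℝ) :
    IsClosed {A : Fin D → Fin d → ℝ |
      ∃ y : Fin d → ℝ, (∀ i, |y i| ≤ δ) ∧ f (Matrix.mulVec A y) = a} := by
  have hK : IsCompact (Set.univ.pi fun _ : Fin d => Set.Icc (-δ) δ) :=
    isCompact_univ_pi fun _ => isCompact_Icc
  have := isCompact_iff_compactSpace.1 hK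
  have hc : Continuous fun q : (Fin D → Fin d → ℝ) × (Set.univ.pi fun _ : Fin d => Set.Icc (-δ) δ) =>
      f (Matrix.mulVec q.1 q.2.1) :=
    hf.comp (Continuous.matrix_mulVec continuous_fst (continuous_subtype_val.comp continuous_snd))
  convert isClosedMap_fst_of_compactSpace _ (isClosed_singleton.preimage hc : IsClosed (_ ⁻¹' {a}))
    using 1
  ext A
  simp [abs_le, Pi.le_def, forall_and]

lemma exists_sq_sum_eq_sInf {D : ℕ} {f : (Fin D → ℝ) → ℝ} (hf : Continuous f) {a : ℝ}
    (ha : ∃ x, f x = a) :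
    ∃ p : Fin D → ℝ, f p = a ∧ sInf ((fun x : Fin D → ℝ => Real.sqrt (∑ i, x i ^ 2)) ''
      {x : Fin D → ℝ | f x = a}) = Real.sqrt (∑ i, p i ^ 2) := by
  obtain ⟨x₀, hx₀⟩ := ha
  have hcl : IsClosed {x : EuclideanSpace ℝ (Fin D) | f x.ofLp = a} :=
    isClosed_eq (hf.comp (by fun_prop)) continuous_const
  obtain ⟨p, hp, hd⟩ := hcl.exists_infDist_eq_dist ⟨WithLp.toLp 2 x₀, hx₀⟩ 0
  have hnorm : ∀ q : EuclideanSpace ℝ (Fin D), Real.sqrt (∑ i, q.ofLp i ^ 2) = dist 0 q := by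
    intro q
    rw [dist_zero_left, EuclideanSpace.norm_eq]
    simp
  refine ⟨p.ofLp, hp, IsLeast.csInf_eq ⟨⟨_, hp, rfl⟩, ?_⟩⟩
  rintro _ ⟨x, hx, rfl⟩
  simp only
  rw [hnorm p, ← hd]
  exact (Metric.infDist_le_dist_of_mem (y := WithLp.toLp 2 x) hx).trans_eq
    (hnorm (WithLp.toLp 2 x)).symm

lemma exists_submodule_section {n d de : ℕ} (h1 : de ≤ d)
    (U : Matrix (Fin (n + 1)) (Fin de) ℝ) {z : Fin de → ℝ} {r : ℝ}
    (hz : z ≠ 0) (b : OrthonormalBasis (Fin (n + 1)) ℝ (EuclideanSpace ℝ (Fin (n + 1))))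
    (hb : U *ᵥ z = r • (b 0).ofLp) (R : Fin n → Fin d → ℝ) :
    ∃ K : Submodule ℝ (EuclideanSpace ℝ (Fin d)), Module.finrank ℝ K = d - de + 1 ∧
      ∀ y ∈ K, ∀ x : Fin d → ℝ,
        Uᵀ *ᵥ (Matrix.of (fun i j => ∑ k, (Fin.cons x R : Fin (n + 1) → Fin d → ℝ) k j * b k i)
          *ᵥ y.ofLp) = (x ⬝ᵥ y.ofLp) • Uᵀ *ᵥ (b 0).ofLp := by
  let B : Matrix (Fin (n + 1)) (Fin d) ℝ := fun i j => ∑ k : Fin n, R k j * b k.succ i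
  let M : EuclideanSpace ℝ (Fin d) →ₗ[ℝ] (Fin de → ℝ) :=
    (Uᵀ * B).mulVecLin ∘ₗ (WithLp.linearEquiv 2 ℝ (Fin d → ℝ)).toLinearMap
  have hM : ∀ y, M y = Uᵀ *ᵥ (B *ᵥ y.ofLp) := fun y => by
    rw [Matrix.mulVec_mulVec]; rfl
  have hbB : (b 0).ofLp ᵥ* B = 0 := by
    ext j
    simp only [Matrix.vecMul, dotProduct, B, Finset.mul_sum, Pi.zero_apply]
    rw [Finset.sum_comm]
    refine Finset.sum_eq_zero fun k _ => ?_
    have h0 : inner ℝ (b k.succ) (b 0) = 0 := b.orthonormal.2 (Fin.succ_ne_zero k)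
    simp only [PiLp.inner_apply, RCLike.inner_apply, conj_trivial] at h0
    calc _ = R k j * ∑ i, (b 0).ofLp i * (b k.succ).ofLp i := by
          rw [Finset.mul_sum]
          exact Finset.sum_congr rfl fun i _ => by ring
      _ = 0 := by rw [h0, mul_zero]
  let φ : Module.Dual ℝ (Fin de → ℝ) := dotProductBilin ℝ ℝ z
  have hφ : ∀ v, φ v = z ⬝ᵥ v := fun v => rfl
  have hφ0 : φ ≠ 0 := fun h => hz (dotProduct_self_eq_zero.1 (by rw [← hφ, h]; rfl))
  have hrange : LinearMap.range M ≤ LinearMap.ker φ := by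
    rintro _ ⟨y, rfl⟩
    rw [LinearMap.mem_ker, hφ, hM, Matrix.dotProduct_mulVec, Matrix.vecMul_transpose, hb,
      Matrix.dotProduct_mulVec, Matrix.smul_vecMul, hbB, smul_zero, zero_dotProduct]
  have hf1 := Submodule.finrank_mono hrange
  have hf2 := Module.Dual.finrank_ker_add_one_of_ne_zero hφ0
  have hf3 := M.finrank_range_add_finrank_ker
  rw [finrank_euclideanSpace_fin] at hf3
  rw [Module.finrank_fin_fun] at hf2
  obtain ⟨K, hKM, hK⟩ := Submodule.exists_le_finrank_eq (LinearMap.ker M)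
    (k := d - de + 1) (by omega)
  refine ⟨K, hK, fun y hy x => ?_⟩
  have hdec : Matrix.of (fun i j => ∑ k, (Fin.cons x R : Fin (n + 1) → Fin d → ℝ) k j * b k i)
      = Matrix.vecMulVec (b 0).ofLp x + B := by
    ext i j
    change ∑ k, (Fin.cons x R : Fin (n + 1) → Fin d → ℝ) k j * b k i
      = (b 0).ofLp i * x j + ∑ k : Fin n, R k j * b k.succ i
    rw [Fin.sum_univ_succ]
    simp [mul_comm]
  have hy0 : Uᵀ *ᵥ (B *ᵥ y.ofLp) = 0 := by rw [← hM]; exact hKM hy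
  rw [hdec, Matrix.add_mulVec, Matrix.mulVec_add, hy0, add_zero, Matrix.vecMulVec_mulVec]
  simp [Matrix.mulVec_smul]

lemma Submodule.exists_inner_eq_and_norm_le {E : Type*} [NormedAddCommGroup E]
    [InnerProductSpace ℝ E] (K : Submodule ℝ E) [K.HasOrthogonalProjection] {r δ : ℝ} (hr : 0 < r)
    (hδ : 0 < δ) {x : E} (hx : r ^ 2 / δ ^ 2 ≤ ‖K.orthogonalProjectionOnto x‖ ^ 2) :
    ∃ y ∈ K, inner ℝ y x = r ∧ ‖y‖ ≤ δ := by
  set w := K.orthogonalProjectionOnto x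
  have hw : inner ℝ (w : E) x = ‖w‖ ^ 2 := by
    rw [← K.inner_orthogonalProjectionOnto_eq_of_mem_left, real_inner_self_eq_norm_sq]
  have hw0 : 0 < ‖w‖ := by
    have : 0 < ‖w‖ ^ 2 := lt_of_lt_of_le (by positivity) hx
    refine lt_of_le_of_ne (norm_nonneg _) fun h => ?_
    simp [← h] at this
  have hle : r ≤ ‖w‖ * δ := by
    rw [← div_pow] at hx
    exact (div_le_iff₀ hδ).1 ((pow_le_pow_iff_left₀ (by positivity) hw0.le two_ne_zero).1 hx)
  refine ⟨(r / ‖w‖ ^ 2) • (w : E), K.smul_mem _ w.2, ?_, ?_⟩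
  · rw [real_inner_smul_left, hw]
    field_simp
  · rw [norm_smul, Real.norm_of_nonneg (by positivity), Submodule.norm_coe,
      div_mul_eq_mul_div, div_le_iff₀ (by positivity)]
    nlinarith

theorem stmt8 (D d de : ℕ) (hD : 0 < D) (hd : 0 < d) (hde : 0 < de)
    (h1 : de ≤ d) (h2 : d ≤ D)
    (f : (Fin D → ℝ) → ℝ) (hf : Continuous f)
    (U : Matrix (Fin D) (Fin de) ℝ) (hU : U.transpose * U = 1)
    (heff : ∀ x : Fin D → ℝ, f x = f (U.mulVec (U.transpose.mulVec x)))
    (fstar : ℝ) (hlb : ∀ x : Fin D → ℝ, fstar ≤ f x)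
    (hatt : ∃ x : Fin D → ℝ, f x = fstar)
    (mustar : ℝ)
    (hmu : mustar = sInf ((fun x : Fin D → ℝ => Real.sqrt (∑ i, x i ^ 2)) ''
      {x : Fin D → ℝ | f x = fstar})) :
    ∀ δ : ℝ, 0 < δ →
      chiSq (d - de + 1) {t : ℝ | mustar ^ 2 / δ ^ 2 ≤ t}
        ≤ gaussMatrix D d
            {A | ∃ y : Fin d → ℝ, (∀ i, |y i| ≤ δ) ∧ f (Matrix.mulVec A y) = fstar} := by
  intro δ hδ
  obtain ⟨n, rfl⟩ : ∃ n, D = n + 1 := ⟨D - 1, by omega⟩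
  obtain ⟨p, hp, hpmu⟩ := exists_sq_sum_eq_sInf hf hatt
  rw [hpmu] at hmu
  have hmusq : mustar ^ 2 = p ⬝ᵥ p := by
    rw [hmu, Real.sq_sqrt (Finset.sum_nonneg fun i _ => sq_nonneg _)]
    exact Finset.sum_congr rfl fun i _ => sq _
  set z := Uᵀ *ᵥ p with hz
  have hUz : (U *ᵥ z) ⬝ᵥ (U *ᵥ z) = z ⬝ᵥ z := by
    rw [Matrix.dotProduct_mulVec, ← Matrix.mulVec_transpose, Matrix.mulVec_mulVec, hU,
      Matrix.one_mulVec]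
  have hpz : p ⬝ᵥ (U *ᵥ z) = z ⬝ᵥ z := by
    rw [Matrix.dotProduct_mulVec, ← Matrix.mulVec_transpose]
  have hzp : z ⬝ᵥ z ≤ p ⬝ᵥ p := by
    have h0 : 0 ≤ (p - U *ᵥ z) ⬝ᵥ (p - U *ᵥ z) :=
      Finset.sum_nonneg fun i _ => mul_self_nonneg _
    rw [sub_dotProduct, dotProduct_sub, dotProduct_sub, dotProduct_comm (U *ᵥ z) p, hUz,
      hpz] at h0
    linarith
  have hsol : ∀ v, Uᵀ *ᵥ v = z → f v = fstar := fun v hv => by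
    rw [heff v, hv, hz, ← heff, hp]
  by_cases hz0 : z = 0
  · have : IsProbabilityMeasure (chiSq (d - de + 1)) :=
      isProbabilityMeasure_gammaMeasure (by positivity) (by norm_num)
    have : IsProbabilityMeasure (gaussMatrix (n + 1) d) := by unfold gaussMatrix; infer_instance
    have huniv : {A : Fin (n + 1) → Fin d → ℝ | ∃ y : Fin d → ℝ, (∀ i, |y i| ≤ δ) ∧
        f (Matrix.mulVec A y) = fstar} = Set.univ := Set.eq_univ_of_forall fun A =>
      ⟨0, fun i => by simpa using hδ.le, hsol _ (by
        rw [hz0]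
        exact (congrArg _ (Matrix.mulVec_zero _)).trans (Matrix.mulVec_zero _))⟩
    rw [huniv, measure_univ]
    exact prob_le_one
  set r := Real.sqrt (z ⬝ᵥ z) with hr
  have hzz : 0 < z ⬝ᵥ z :=
    lt_of_le_of_ne (Finset.sum_nonneg fun i _ => mul_self_nonneg _) fun h =>
      hz0 (dotProduct_self_eq_zero.1 h.symm)
  have hr0 : 0 < r := Real.sqrt_pos.2 hzz
  have hrsq : r ^ 2 = z ⬝ᵥ z := Real.sq_sqrt hzz.le
  let u : EuclideanSpace ℝ (Fin (n + 1)) := WithLp.toLp 2 (r⁻¹ • U *ᵥ z)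
  have hu : ‖u‖ = 1 := by
    have h : ‖u‖ ^ 2 = 1 := by
      rw [EuclideanSpace.real_norm_sq_eq]
      calc ∑ i, u.ofLp i ^ 2 = r⁻¹ ^ 2 * ((U *ᵥ z) ⬝ᵥ (U *ᵥ z)) := by
            rw [dotProduct, Finset.mul_sum]
            exact Finset.sum_congr rfl fun i _ => by simp [u]; ring
        _ = 1 := by rw [hUz, ← hrsq]; field_simp
    exact (pow_eq_one_iff_of_nonneg (norm_nonneg _) two_ne_zero).1 h
  obtain ⟨b, hb⟩ := Orthonormal.exists_orthonormalBasis_extension_of_card_eq (𝕜 := ℝ)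
    (E := EuclideanSpace ℝ (Fin (n + 1))) (ι := Fin (n + 1)) (by simp)
    (v := fun _ => u) (s := {0}) ⟨fun _ => hu, fun i j hij => absurd (Subsingleton.elim i j) hij⟩
  have hbz : U *ᵥ z = r • (b 0).ofLp := by
    rw [hb 0 rfl]
    simp [u, smul_smul, hr0.ne']
  have hmp := measurePreserving_orthonormalBasis_gaussMatrix d b
  have hS := (isClosed_setOf_exists_box (d := d) hf δ fstar).measurableSet
  rw [← hmp.measure_preimage hS.nullMeasurableSet]
  refine le_gaussMatrix_of_forall_section (Nat.succ_pos _) _ (hmp.measurable hS) fun R => ?_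
  obtain ⟨K, hK, hKy⟩ := exists_submodule_section h1 U hz0 b hbz R
  refine ⟨K, hK, fun x hx => ?_⟩
  obtain ⟨y, hyK, hyx, hyδ⟩ := K.exists_inner_eq_and_norm_le hr0 hδ (x := x)
    (le_trans (by rw [hrsq, hmusq]; gcongr) hx)
  refine ⟨y.ofLp, fun i => (PiLp.norm_apply_le y i).trans hyδ, hsol _ ?_⟩
  have hxy : x.ofLp ⬝ᵥ y.ofLp = r := by
    rw [← hyx, PiLp.inner_apply]
    rfl
  refine (hKy y hyK x.ofLp).trans ?_
  rw [hxy, ← Matrix.mulVec_smul, ← hbz, Matrix.mulVec_mulVec, hU, Matrix.one_mulVec]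
end

section
/- Let D, d, d_e be positive integers with d_e ≤ d ≤ D and set n = d − d_e + 1. Let f : ℝ^D → ℝ be continuous with effective subspace spanned by the columns of a matrix U ∈ ℝ^{D×d_e} with orthonormal columns, i.e. f(x) = f(U Uᵀ x) for all x. Assume f attains a global minimum f*, let G = {x ∈ ℝ^D : f(x) = f*} (nonempty) and μ* = inf{‖x‖₂ : x ∈ G}. Then for every δ > 0, the Gaussian-matrix-measure of the set {A : ∃ y ∈ ℝ^d with ‖y‖_∞ ≤ δ and f(A y) = f*} is at least 1 − C(n) · (1 + (n/2)·e^{−(μ*)²/(2δ²)}) · (μ*/(√2·δ))^n, where C(n) = 4 / (n(n+2)Γ(n/2)). -/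
open MeasureTheory ProbabilityTheory Matrix

lemma charFunDual_gaussianReal_zero_one (L : StrongDual ℝ ℝ) :
    charFunDual (gaussianReal 0 1) L = Complex.exp (-(((L 1) ^ 2 / 2 : ℝ) : ℂ)) := by
  have h : ∀ x, L x = L 1 * x := fun x => by
    have := L.map_smul x 1
    simp only [smul_eq_mul, mul_one] at this
    rw [this, mul_comm]
  rw [charFunDual_apply, integral_congr_ae (ae_of_all _ fun x => by rw [h x])]
  have := charFun_gaussianReal (μ := 0) (v := 1) (L 1)
  rw [charFun_apply_real] at this
  simp only [Complex.ofReal_mul, this]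
  congr 1
  push_cast
  simp

lemma charFunDual_pi_gaussianReal {ι : Type*} [Fintype ι] [DecidableEq ι]
    (L : StrongDual ℝ (ι → ℝ)) :
    charFunDual (Measure.pi fun _ : ι => gaussianReal 0 1) L =
      Complex.exp (-((∑ i, (L (Pi.single i 1)) ^ 2 / 2 : ℝ) : ℂ)) := by
  rw [charFunDual_pi]
  simp_rw [charFunDual_gaussianReal_zero_one]
  rw [← Complex.exp_sum]
  simp [Finset.sum_neg_distrib]

lemma charFunDual_gaussMatrix {D d : ℕ} (L : StrongDual ℝ (Fin D → Fin d → ℝ)) :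
    charFunDual (gaussMatrix D d) L =
      Complex.exp (-((∑ k, ∑ i, (L (Pi.single i (Pi.single k 1))) ^ 2 / 2 : ℝ) : ℂ)) := by
  rw [gaussMatrix, charFunDual_pi]
  simp_rw [charFunDual_pi_gaussianReal]
  rw [← Complex.exp_sum, Finset.sum_comm]
  simp [Finset.sum_neg_distrib]

lemma sum_sq_transpose_mulVec {m n : Type*} [Fintype m] [Fintype n] [DecidableEq m]
    {V : Matrix m n ℝ} (hV : V * V.transpose = 1) (a : m → ℝ) :
    ∑ i, (∑ j, V j i * a j) ^ 2 = ∑ j, a j ^ 2 := by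
  have h1 : ∀ b : n → ℝ, ∑ i, b i ^ 2 = b ⬝ᵥ b := fun b => by simp [dotProduct, sq]
  have h2 : ∀ b : m → ℝ, ∑ i, b i ^ 2 = b ⬝ᵥ b := fun b => by simp [dotProduct, sq]
  have h3 : (fun i => ∑ j, V j i * a j) = V.transpose.mulVec a := by
    ext i; simp [mulVec, dotProduct]
  have h4 := h1 (V.transpose.mulVec a)
  rw [← h3] at h4
  rw [h4, h2, h3, dotProduct_mulVec, vecMul_transpose, mulVec_mulVec, hV, one_mulVec]

lemma map_mulVec_pi_gaussianReal {m n : Type*} [Fintype m] [Fintype n] [DecidableEq m]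
    [DecidableEq n] {W : Matrix m n ℝ} (hW : W * W.transpose = 1) :
    (Measure.pi fun _ : n => gaussianReal 0 1).map W.mulVec =
      Measure.pi fun _ : m => gaussianReal 0 1 := by
  let T : (n → ℝ) →L[ℝ] (m → ℝ) := W.mulVecLin.toContinuousLinearMap
  have hT : W.mulVec = T := rfl
  rw [hT]
  have : IsProbabilityMeasure ((Measure.pi fun _ : n => gaussianReal 0 1).map T) :=
    Measure.isProbabilityMeasure_map (by fun_prop)
  apply Measure.ext_of_charFunDual
  ext L
  rw [charFunDual_map, charFunDual_pi_gaussianReal, charFunDual_pi_gaussianReal]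
  simp_rw [← Finset.sum_div]
  rw [← sum_sq_transpose_mulVec hW]
  congr! 7 with i
  have : T (Pi.single i 1) = ∑ j, W j i • (Pi.single j 1 : m → ℝ) := by
    ext j
    simp [T, Pi.single_apply]
  simp [this]

lemma map_mul_gaussMatrix {m D : ℕ} (d : ℕ) {V : Matrix (Fin m) (Fin D) ℝ}
    (hV : V * V.transpose = 1) :
    (gaussMatrix D d).map (fun A i k => ∑ j, V i j * A j k) = gaussMatrix m d := by
  let T : (Fin D → Fin d → ℝ) →L[ℝ] (Fin m → Fin d → ℝ) :=
    LinearMap.toContinuousLinearMap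
      { toFun := fun A i k => ∑ j, V i j * A j k
        map_add' := fun A B => Matrix.mul_add V (of A) (of B)
        map_smul' := fun c A => Matrix.mul_smul V c (of A) }
  have hT : (fun A i k => ∑ j, V i j * A j k) = T := rfl
  rw [hT]
  have h0 : ∀ a b, IsProbabilityMeasure (gaussMatrix a b) := fun a b => by
    unfold gaussMatrix; infer_instance
  have : IsProbabilityMeasure ((gaussMatrix D d).map T) :=
    Measure.isProbabilityMeasure_map (by fun_prop)
  apply Measure.ext_of_charFunDual
  ext L
  rw [charFunDual_map, charFunDual_gaussMatrix, charFunDual_gaussMatrix]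
  simp_rw [← Finset.sum_div]
  congr 4
  refine Finset.sum_congr rfl fun k _ => ?_
  rw [← sum_sq_transpose_mulVec hV]
  refine Finset.sum_congr rfl fun i _ => ?_
  have : T (Pi.single i (Pi.single k 1)) =
      ∑ j, V j i • (Pi.single j (Pi.single k 1) : Fin m → Fin d → ℝ) := by
    ext j l
    have hTv : ∀ A, T A j l = ∑ p, V j p * A p l := fun _ => rfl
    rw [hTv]
    simp [Pi.single_apply, Finset.sum_apply, ite_apply]
  simp [this]

lemma pi_gaussianReal_eq_withDensity (n : ℕ) :
    (Measure.pi fun _ : Fin n => gaussianReal 0 1) =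
      (volume : Measure (Fin n → ℝ)).withDensity
        (fun x => ENNReal.ofReal (∏ i, gaussianPDFReal 0 1 (x i))) := by
  refine Measure.pi_eq fun s hs => ?_
  rw [withDensity_apply _ (MeasurableSet.univ_pi hs), volume_pi, Measure.restrict_pi_pi,
    ← ofReal_integral_eq_lintegral_ofReal, integral_fintype_prod_eq_prod,
    ENNReal.ofReal_prod_of_nonneg]
  · simp_rw [gaussianReal_apply_eq_integral 0 one_ne_zero]
  · exact fun i _ => integral_nonneg fun x => gaussianPDFReal_nonneg 0 1 x
  · exact Integrable.fintype_prod fun i => (integrable_gaussianPDFReal 0 1).restrict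
  · exact ae_of_all _ fun x => Finset.prod_nonneg fun i _ => gaussianPDFReal_nonneg 0 1 _

lemma prod_gaussianPDFReal {n : ℕ} (x : EuclideanSpace ℝ (Fin n)) :
    ∏ i, gaussianPDFReal 0 1 (x i) =
      (√(2 * Real.pi))⁻¹ ^ n * Real.exp (-(‖x‖ ^ 2 / 2)) := by
  simp_rw [gaussianPDFReal, Finset.prod_mul_distrib, ← Real.exp_sum, EuclideanSpace.real_norm_sq_eq]
  simp [Finset.sum_div, neg_div, Finset.sum_neg_distrib]

lemma exp_neg_sq_div_two_le {r t : ℝ} (hr : 0 < r) (h0 : 0 ≤ t) (h1 : t ≤ r) :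
    Real.exp (-(t ^ 2 / 2)) ≤ 1 - t ^ 2 / r ^ 2 * (1 - Real.exp (-(r ^ 2 / 2))) := by
  have ha : 0 ≤ t ^ 2 / r ^ 2 := by positivity
  have hb : t ^ 2 / r ^ 2 ≤ 1 := by
    rw [div_le_one (by positivity)]; gcongr
  have := convexOn_exp.2 (Set.mem_univ (0 : ℝ)) (Set.mem_univ (-(r ^ 2 / 2)))
    (sub_nonneg.2 hb) ha (by ring)
  simp only [smul_eq_mul, mul_zero, zero_add, Real.exp_zero, mul_one] at this
  have h2 : t ^ 2 / r ^ 2 * -(r ^ 2 / 2) = -(t ^ 2 / 2) := by field_simp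
  rw [h2] at this
  linarith

lemma integral_pow_mul_one_sub_sq {n : ℕ} (hn : 0 < n) {r : ℝ} (hr : 0 < r) (c : ℝ) :
    ∫ t in Set.Ioo 0 r, t ^ (n - 1) * (1 - t ^ 2 / r ^ 2 * c) =
      r ^ n * (1 / n - c / (n + 2)) := by
  obtain ⟨m, rfl⟩ := Nat.exists_eq_add_of_lt hn
  rw [← integral_Ioc_eq_integral_Ioo, ← intervalIntegral.integral_of_le hr.le]
  have : ∀ t : ℝ, t ^ (0 + m + 1 - 1) * (1 - t ^ 2 / r ^ 2 * c) =
      t ^ m - c / r ^ 2 * t ^ (m + 2) := fun t => by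
    simp only [zero_add, Nat.add_sub_cancel]; ring
  simp_rw [this]
  rw [intervalIntegral.integral_sub (Continuous.intervalIntegrable (by fun_prop) _ _)
      (Continuous.intervalIntegrable (by fun_prop) _ _),
    intervalIntegral.integral_const_mul, integral_pow, integral_pow]
  push_cast
  have : (m : ℝ) + 1 + 2 ≠ 0 := by positivity
  have : (m : ℝ) + 2 + 1 ≠ 0 := by positivity
  have : (m : ℝ) + 1 ≠ 0 := by positivity
  simp
  field_simp
  ring

lemma pi_gaussianReal_ball_le {n : ℕ} (hn : 0 < n) {r : ℝ} (hr : 0 < r) :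
    (Measure.pi fun _ : Fin n => gaussianReal 0 1) {x | ∑ i, x i ^ 2 < r ^ 2} ≤
      ENNReal.ofReal ((4 / ((n : ℝ) * ((n : ℝ) + 2) * Real.Gamma ((n : ℝ) / 2))) *
          (1 + ((n : ℝ) / 2) * Real.exp (-(r ^ 2 / 2))) * (r / √2) ^ n) := by
  have : Nonempty (Fin n) := ⟨⟨0, hn⟩⟩
  set E := Real.exp (-(r ^ 2 / 2))
  let g : ℝ → ℝ := (Set.Iio r).indicator fun t => 1 - t ^ 2 / r ^ 2 * (1 - E)
  have hS : MeasurableSet {x : Fin n → ℝ | ∑ i, x i ^ 2 < r ^ 2} :=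
    measurableSet_lt (by fun_prop) (by fun_prop)
  have hmul : (fun t : ℝ => t ^ (n - 1) • g t) =
      (Set.Iio r).indicator fun t => t ^ (n - 1) * (1 - t ^ 2 / r ^ 2 * (1 - E)) := by
    ext t; by_cases h : t ∈ Set.Iio r <;> simp [g, h]
  have hint : IntegrableOn (fun t : ℝ => t ^ (n - 1) * (1 - t ^ 2 / r ^ 2 * (1 - E)))
      (Set.Ioo 0 r) :=
    (Continuous.integrableOn_Icc (by fun_prop)).mono_set Set.Ioo_subset_Icc_self
  have hgint : Integrable (fun x : EuclideanSpace ℝ (Fin n) => g ‖x‖) := by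
    rw [integrable_fun_norm_addHaar, finrank_euclideanSpace_fin, hmul, IntegrableOn,
      integrable_indicator_iff measurableSet_Iio, IntegrableOn,
      Measure.restrict_restrict measurableSet_Iio, Set.Iio_inter_Ioi]
    exact hint
  have hval : ∫ x : EuclideanSpace ℝ (Fin n), g ‖x‖ =
      n * (√Real.pi ^ n / Real.Gamma (n / 2 + 1)) *
        (r ^ n * (1 / n - (1 - E) / (n + 2))) := by
    rw [integral_fun_norm_addHaar, finrank_euclideanSpace_fin, hmul,
      setIntegral_indicator measurableSet_Iio, Set.Ioi_inter_Iio,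
      integral_pow_mul_one_sub_sq hn hr, Measure.real, EuclideanSpace.volume_ball]
    simp only [ENNReal.ofReal_one, one_pow, one_mul, Fintype.card_fin, nsmul_eq_mul, smul_eq_mul]
    rw [ENNReal.toReal_ofReal (by positivity), mul_assoc]
  have hg0 : ∀ x : EuclideanSpace ℝ (Fin n), 0 ≤ g ‖x‖ := fun x => by
    refine Set.indicator_apply_nonneg fun h => ?_
    exact (Real.exp_pos _).le.trans (exp_neg_sq_div_two_le hr (norm_nonneg x) (le_of_lt h))
  calc (Measure.pi fun _ : Fin n => gaussianReal 0 1) {x | ∑ i, x i ^ 2 < r ^ 2}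
      = ∫⁻ x in {x : Fin n → ℝ | ∑ i, x i ^ 2 < r ^ 2},
          ENNReal.ofReal (∏ i, gaussianPDFReal 0 1 (x i)) := by
        rw [pi_gaussianReal_eq_withDensity, withDensity_apply _ hS]
    _ = ∫⁻ x : EuclideanSpace ℝ (Fin n), {x : Fin n → ℝ | ∑ i, x i ^ 2 < r ^ 2}.indicator
          (fun x => ENNReal.ofReal (∏ i, gaussianPDFReal 0 1 (x i))) x.ofLp := by
        rw [← lintegral_indicator hS]
        exact ((PiLp.volume_preserving_ofLp (Fin n)).lintegral_comp_emb
          (MeasurableEquiv.toLp 2 (Fin n → ℝ)).symm.measurableEmbedding _).symm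
    _ ≤ ∫⁻ x : EuclideanSpace ℝ (Fin n),
          ENNReal.ofReal ((√(2 * Real.pi))⁻¹ ^ n * g ‖x‖) := by
        refine lintegral_mono fun x => ?_
        by_cases h : ∑ i, x.ofLp i ^ 2 < r ^ 2
        · have hx : ‖x‖ < r := by
            rw [← EuclideanSpace.real_norm_sq_eq] at h
            exact lt_of_pow_lt_pow_left₀ 2 hr.le h
          rw [Set.indicator_of_mem (by exact h), prod_gaussianPDFReal]
          refine ENNReal.ofReal_le_ofReal (mul_le_mul_of_nonneg_left ?_ (by positivity))
          simp only [g]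
          rw [Set.indicator_of_mem (by exact hx)]
          exact exp_neg_sq_div_two_le hr (norm_nonneg x) hx.le
        · rw [Set.indicator_of_notMem (by exact h)]
          exact zero_le
    _ = ENNReal.ofReal ((√(2 * Real.pi))⁻¹ ^ n * ∫ x : EuclideanSpace ℝ (Fin n), g ‖x‖) := by
        rw [← integral_const_mul, ofReal_integral_eq_lintegral_ofReal (hgint.const_mul _)
          (ae_of_all _ fun x => mul_nonneg (by positivity) (hg0 x))]
    _ = _ := by
        congr 1
        have hn' : (0 : ℝ) < n := by exact_mod_cast hn
        have hG := Real.Gamma_pos_of_pos (half_pos hn')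
        rw [hval, Real.Gamma_add_one (by positivity), Real.sqrt_mul (by norm_num), mul_inv, mul_pow,
          div_pow, inv_pow, inv_pow]
        have : (0 : ℝ) < √Real.pi ^ n := by positivity
        have : (0 : ℝ) < √2 ^ n := by positivity
        field_simp
        ring

lemma exists_orthonormal_rows_mulVec_eq_zero {m d n : ℕ} (h : n + m ≤ d)
    (c : Fin m → Fin d → ℝ) :
    ∃ W : Matrix (Fin n) (Fin d) ℝ, W * W.transpose = 1 ∧ ∀ j, W.mulVec (c j) = 0 := by
  let S : Submodule ℝ (EuclideanSpace ℝ (Fin d)) :=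
    Submodule.span ℝ (Set.range fun j => WithLp.toLp 2 (c j))
  have hS : Module.finrank ℝ S ≤ m := by
    have := finrank_range_le_card (R := ℝ) (fun j => WithLp.toLp 2 (c j))
    rwa [Fintype.card_fin] at this
  have hK : n ≤ Module.finrank ℝ Sᗮ := by
    have := S.finrank_add_finrank_orthogonal
    rw [finrank_euclideanSpace_fin] at this
    omega
  let b := stdOrthonormalBasis ℝ Sᗮ
  refine ⟨of fun i => (b (Fin.castLE hK i) : EuclideanSpace ℝ (Fin d)).ofLp, ?_, fun j => ?_⟩
  · ext i k
    have := orthonormal_iff_ite.1 b.orthonormal (Fin.castLE hK i) (Fin.castLE hK k)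
    rw [Submodule.coe_inner, PiLp.inner_apply] at this
    simp only [RCLike.inner_apply, conj_trivial, Fin.castLE_inj] at this
    rw [Matrix.mul_apply, Matrix.one_apply, ← this]
    exact Finset.sum_congr rfl fun l _ => mul_comm _ _
  · ext i
    have h1 : WithLp.toLp 2 (c j) ∈ S := Submodule.subset_span ⟨j, rfl⟩
    have := Submodule.inner_right_of_mem_orthogonal h1 (b (Fin.castLE hK i)).2
    rw [PiLp.inner_apply] at this
    simp only [RCLike.inner_apply, conj_trivial] at this
    exact this

lemma exists_orthogonal_matrix_smul_row {m : ℕ} (z : Fin (m + 1) → ℝ) :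
    ∃ Q : Matrix (Fin (m + 1)) (Fin (m + 1)) ℝ, Q * Q.transpose = 1 ∧
      z = √(∑ i, z i ^ 2) • Q 0 := by
  let z' : EuclideanSpace ℝ (Fin (m + 1)) := WithLp.toLp 2 z
  have hz' : ‖z'‖ = √(∑ i, z i ^ 2) := by simp [z', EuclideanSpace.norm_eq]
  obtain ⟨b, hb⟩ : ∃ b : OrthonormalBasis (Fin (m + 1)) ℝ (EuclideanSpace ℝ (Fin (m + 1))),
      z' = ‖z'‖ • b 0 := by
    by_cases hz : z' = 0
    · exact ⟨EuclideanSpace.basisFun _ _, by simp [hz]⟩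
    · have hv : Orthonormal ℝ (({0} : Set (Fin (m + 1))).domRestrict fun _ => ‖z'‖⁻¹ • z') := by
        constructor
        · intro i
          simp [norm_smul, hz]
        · intro i j hij
          exact absurd (Subsingleton.elim i j) hij
      obtain ⟨b, hb⟩ := hv.exists_orthonormalBasis_extension_of_card_eq (by simp)
      refine ⟨b, ?_⟩
      rw [hb 0 rfl, smul_smul, mul_inv_cancel₀ (norm_ne_zero_iff.2 hz), one_smul]
  refine ⟨of fun i => (b i).ofLp, ?_, ?_⟩
  · ext i k
    have := orthonormal_iff_ite.1 b.orthonormal i k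
    rw [PiLp.inner_apply] at this
    simpa [Matrix.mul_apply, Matrix.one_apply, mul_comm] using this
  · rw [← hz']
    exact congrArg WithLp.ofLp hb

lemma exists_bounded_solution {m n : Type*} [Fintype m] [Fintype n] [DecidableEq m]
    {W : Matrix m n ℝ} (hW : W * W.transpose = 1) {ρ δ : ℝ} (hρ : 0 ≤ ρ) (hδ : 0 < δ)
    {b : n → ℝ} (hb : (ρ / δ) ^ 2 ≤ ∑ k, (W.mulVec b k) ^ 2) :
    ∃ y : n → ℝ, (∀ i, |y i| ≤ δ) ∧ b ⬝ᵥ y = ρ ∧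
      ∀ c : n → ℝ, W.mulVec c = 0 → c ⬝ᵥ y = 0 := by
  rcases hρ.eq_or_lt with rfl | hρ
  · exact ⟨0, by simp [hδ.le], by simp, by simp⟩
  set s := ∑ k, (W.mulVec b k) ^ 2 with hs
  have hs' : W.mulVec b ⬝ᵥ W.mulVec b = s := by simp [hs, dotProduct, sq]
  have hs0 : 0 < s := lt_of_lt_of_le (by positivity) hb
  have key : ∀ c, c ⬝ᵥ W.transpose.mulVec (W.mulVec b) = W.mulVec c ⬝ᵥ W.mulVec b := fun c => by
    rw [dotProduct_mulVec, vecMul_transpose]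
  refine ⟨(ρ / s) • W.transpose.mulVec (W.mulVec b), fun i => ?_, ?_, fun c hc => ?_⟩
  · apply abs_le_of_sq_le_sq _ hδ.le
    set w := W.transpose.mulVec (W.mulVec b) with hw
    have h1 : ∑ j, w j ^ 2 = s := by
      have : w ⬝ᵥ w = s := by
        rw [hw, key, mulVec_mulVec, hW, one_mulVec, hs']
      simpa [dotProduct, sq] using this
    have h2 : w i ^ 2 ≤ s := h1 ▸ Finset.single_le_sum (f := fun j => w j ^ 2)
      (fun j _ => sq_nonneg _) (Finset.mem_univ i)
    calc ((ρ / s) • w) i ^ 2 = (ρ / s) ^ 2 * w i ^ 2 := by simp [mul_pow]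
      _ ≤ (ρ / s) ^ 2 * s := by gcongr
      _ = ρ ^ 2 / s := by field_simp
      _ ≤ δ ^ 2 := by
        rw [div_pow, div_le_iff₀ (by positivity)] at hb
        rw [div_le_iff₀ hs0]
        linarith
  · rw [dotProduct_smul, key, hs', smul_eq_mul, div_mul_cancel₀ _ hs0.ne']
  · rw [dotProduct_smul, key, hc, zero_dotProduct, smul_zero]

/-- Upper bound for the probability that the random linear system has no solution in the
search box, as a function of the ratio between the norm of the target and the box radius. -/
noncomputable def failureBound (n : ℕ) (r : ℝ) : ℝ :=
  (4 / ((n : ℝ) * ((n : ℝ) + 2) * Real.Gamma ((n : ℝ) / 2))) *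
    (1 + ((n : ℝ) / 2) * Real.exp (-(r ^ 2 / 2))) * (r / √2) ^ n

lemma pi_gaussianReal_solvable_ge {m d n : ℕ} (hn : 0 < n) (h : n + m ≤ d) {ρ δ : ℝ}
    (hρ : 0 ≤ ρ) (hδ : 0 < δ) (c : Fin m → Fin d → ℝ) :
    ENNReal.ofReal (1 - failureBound n (ρ / δ)) ≤ (Measure.pi fun _ : Fin d => gaussianReal 0 1)
      {b | ∃ y : Fin d → ℝ, (∀ i, |y i| ≤ δ) ∧ b ⬝ᵥ y = ρ ∧ ∀ j, c j ⬝ᵥ y = 0} := by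
  obtain ⟨W, hW, hWc⟩ := exists_orthonormal_rows_mulVec_eq_zero h c
  set G := Measure.pi fun _ : Fin d => gaussianReal 0 1
  have hS : MeasurableSet {x : Fin n → ℝ | ∑ i, x i ^ 2 < (ρ / δ) ^ 2} :=
    measurableSet_lt (by fun_prop) (by fun_prop)
  have hWm : Measurable W.mulVec := (W.mulVecLin.toContinuousLinearMap.continuous).measurable
  have hle : (Measure.pi fun _ : Fin n => gaussianReal 0 1)
      {x | ∑ i, x i ^ 2 < (ρ / δ) ^ 2} ≤ ENNReal.ofReal (failureBound n (ρ / δ)) := by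
    rcases hρ.eq_or_lt with rfl | hρ
    · have : {x : Fin n → ℝ | ∑ i, x i ^ 2 < (0 / δ) ^ 2} = ∅ := by
        ext x
        simpa using Finset.sum_nonneg fun i _ => sq_nonneg (x i)
      rw [this, measure_empty]
      exact zero_le
    · exact pi_gaussianReal_ball_le hn (by positivity)
  calc ENNReal.ofReal (1 - failureBound n (ρ / δ))
      = 1 - ENNReal.ofReal (failureBound n (ρ / δ)) := by
        rw [ENNReal.ofReal_sub, ENNReal.ofReal_one]
        have := Real.Gamma_nonneg_of_nonneg (s := (n : ℝ) / 2) (by positivity)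
        unfold failureBound
        positivity
    _ ≤ 1 - (Measure.pi fun _ : Fin n => gaussianReal 0 1) {x | ∑ i, x i ^ 2 < (ρ / δ) ^ 2} := by
        gcongr
    _ = G (W.mulVec ⁻¹' {x | ∑ i, x i ^ 2 < (ρ / δ) ^ 2}ᶜ) := by
        rw [← Measure.map_apply hWm hS.compl, map_mulVec_pi_gaussianReal hW, prob_compl_eq_one_sub hS]
    _ ≤ _ := by
        refine measure_mono fun b hb => ?_
        obtain ⟨y, hy, hby, hcy⟩ := exists_bounded_solution hW hρ hδ (not_lt.1 hb)
        exact ⟨y, hy, hby, fun j => hcy _ (hWc j)⟩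

lemma isClosed_setOf_bounded_solution {X : Type*} [TopologicalSpace X] {d : ℕ} {δ : ℝ}
    {p : X → (Fin d → ℝ) → Prop} (hp : IsClosed {q : X × (Fin d → ℝ) | p q.1 q.2}) :
    IsClosed {x | ∃ y : Fin d → ℝ, (∀ i, |y i| ≤ δ) ∧ p x y} := by
  let K : Set (Fin d → ℝ) := Set.univ.pi fun _ => Set.Icc (-δ) δ
  have hK : IsCompact K := isCompact_univ_pi fun _ => isCompact_Icc
  have : CompactSpace K := isCompact_iff_compactSpace.1 hK
  have h := isClosedMap_fst_of_compactSpace (X := X) (Y := K) _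
    (hp.preimage (f := fun q : X × K => (q.1, (q.2 : Fin d → ℝ))) (by fun_prop))
  convert h
  ext x
  simp [K, abs_le, Pi.le_def, forall_and]

lemma measurableSet_matrix_solvable (m d : ℕ) (ρ δ : ℝ) :
    MeasurableSet {B : Fin (m + 1) → Fin d → ℝ | ∃ y : Fin d → ℝ, (∀ i, |y i| ≤ δ) ∧
      B 0 ⬝ᵥ y = ρ ∧ ∀ j : Fin m, B j.succ ⬝ᵥ y = 0} := by
  refine (isClosed_setOf_bounded_solution ?_).measurableSet
  simp only [Set.ofPred_and, Set.ofPred_forall, dotProduct]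
  exact (isClosed_eq (by fun_prop) (by fun_prop)).inter
    (isClosed_iInter fun j => isClosed_eq (by fun_prop) (by fun_prop))

lemma gaussMatrix_solvable_ge {m d n : ℕ} (hn : 0 < n) (h : n + m ≤ d) {ρ δ : ℝ}
    (hρ : 0 ≤ ρ) (hδ : 0 < δ) :
    ENNReal.ofReal (1 - failureBound n (ρ / δ)) ≤ gaussMatrix (m + 1) d
      {B | ∃ y : Fin d → ℝ, (∀ i, |y i| ≤ δ) ∧ B 0 ⬝ᵥ y = ρ ∧ ∀ j : Fin m, B j.succ ⬝ᵥ y = 0} := by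
  set G := Measure.pi fun _ : Fin d => gaussianReal 0 1
  have hmp := measurePreserving_piFinSuccAbove (fun _ : Fin (m + 1) => G) 0
  let S : Set ((Fin d → ℝ) × (Fin m → Fin d → ℝ)) :=
    {q | ∃ y : Fin d → ℝ, (∀ i, |y i| ≤ δ) ∧ q.1 ⬝ᵥ y = ρ ∧ ∀ j, q.2 j ⬝ᵥ y = 0}
  have hS : MeasurableSet S := by
    refine (isClosed_setOf_bounded_solution ?_).measurableSet
    simp only [Set.ofPred_and, Set.ofPred_forall, dotProduct]
    exact (isClosed_eq (by fun_prop) (by fun_prop)).inter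
      (isClosed_iInter fun j => isClosed_eq (by fun_prop) (by fun_prop))
  have hpre : {B : Fin (m + 1) → Fin d → ℝ | ∃ y : Fin d → ℝ, (∀ i, |y i| ≤ δ) ∧ B 0 ⬝ᵥ y = ρ ∧
      ∀ j : Fin m, B j.succ ⬝ᵥ y = 0} =
      MeasurableEquiv.piFinSuccAbove (fun _ : Fin (m + 1) => Fin d → ℝ) 0 ⁻¹' S := by
    ext B
    simp [S, MeasurableEquiv.piFinSuccAbove, Fin.tail]
  rw [gaussMatrix, hpre, hmp.measure_preimage hS.nullMeasurableSet,
    Measure.prod_apply_symm hS]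
  calc ENNReal.ofReal (1 - failureBound n (ρ / δ))
      = ∫⁻ _ : Fin m → Fin d → ℝ, ENNReal.ofReal (1 - failureBound n (ρ / δ))
          ∂Measure.pi fun _ => G := by simp
    _ ≤ _ := lintegral_mono fun c => pi_gaussianReal_solvable_ge hn h hρ hδ c

lemma exists_isMinOn_sqrt_sum_sq {D : ℕ} {s : Set (Fin D → ℝ)} (hs : IsClosed s)
    (hne : s.Nonempty) :
    ∃ x ∈ s, √(∑ i, x i ^ 2) = sInf ((fun x : Fin D → ℝ => √(∑ i, x i ^ 2)) '' s) ∧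
      ∀ x' ∈ s, √(∑ i, x i ^ 2) ≤ √(∑ i, x' i ^ 2) := by
  obtain ⟨y, hy, hmin⟩ := (hs.preimage (PiLp.continuous_ofLp 2 fun _ : Fin D => ℝ)
    ).exists_infDist_eq_dist (hne.preimage (WithLp.ofLp_surjective 2)) 0
  have hnorm : ∀ x : EuclideanSpace ℝ (Fin D), dist 0 x = √(∑ i, x.ofLp i ^ 2) := fun x => by
    simp [EuclideanSpace.norm_eq]
  have hle : ∀ x' ∈ s, √(∑ i, y.ofLp i ^ 2) ≤ √(∑ i, x' i ^ 2) := fun x' hx' => by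
    rw [← hnorm y, ← hmin, ← hnorm (WithLp.toLp 2 x')]
    exact Metric.infDist_le_dist_of_mem hx'
  have hleast : IsLeast ((fun x : Fin D → ℝ => √(∑ i, x i ^ 2)) '' s) √(∑ i, y.ofLp i ^ 2) :=
    ⟨⟨_, hy, rfl⟩, Set.forall_mem_image.2 hle⟩
  exact ⟨y.ofLp, hy, hleast.csInf_eq.symm, hle⟩

lemma sum_sq_transpose_mulVec_le {m n : Type*} [Fintype m] [Fintype n] [DecidableEq n]
    {U : Matrix m n ℝ} (hU : U.transpose * U = 1) (x : m → ℝ) :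
    ∑ i, U.transpose.mulVec x i ^ 2 ≤ ∑ i, x i ^ 2 := by
  set w := U.transpose.mulVec x with hw
  have h1 : w ⬝ᵥ w = ∑ i, w i ^ 2 := by simp [dotProduct, sq]
  have h2 : x ⬝ᵥ x = ∑ i, x i ^ 2 := by simp [dotProduct, sq]
  have h3 : U.mulVec w ⬝ᵥ U.mulVec w = w ⬝ᵥ w := by
    rw [dotProduct_comm, dotProduct_mulVec, ← mulVec_transpose, mulVec_mulVec, hU, one_mulVec]
  have h4 : x ⬝ᵥ U.mulVec w = w ⬝ᵥ w := by
    rw [dotProduct_mulVec, ← mulVec_transpose]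
  have h5 : 0 ≤ (x - U.mulVec w) ⬝ᵥ (x - U.mulVec w) :=
    Finset.sum_nonneg fun i _ => mul_self_nonneg _
  rw [sub_dotProduct, dotProduct_sub, dotProduct_sub, dotProduct_comm (U.mulVec w) x, h3, h4] at h5
  linarith

lemma mulVec_mulVec_apply {l m n : Type*} [Fintype m] [Fintype n] (V : Matrix l m ℝ)
    (A : Matrix m n ℝ) (y : n → ℝ) (i : l) :
    V.mulVec (A.mulVec y) i = (fun k => ∑ j, V i j * A j k) ⬝ᵥ y := by
  rw [mulVec_mulVec]
  rfl

theorem stmt9 (D d de : ℕ) (hD : 0 < D) (hd : 0 < d) (hde : 0 < de)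
    (h1 : de ≤ d) (h2 : d ≤ D) (n : ℕ) (hn : n = d - de + 1)
    (f : (Fin D → ℝ) → ℝ) (hf : Continuous f)
    (U : Matrix (Fin D) (Fin de) ℝ) (hU : U.transpose * U = 1)
    (heff : ∀ x : Fin D → ℝ, f x = f (U.mulVec (U.transpose.mulVec x)))
    (fstar : ℝ) (hlb : ∀ x : Fin D → ℝ, fstar ≤ f x)
    (hatt : ∃ x : Fin D → ℝ, f x = fstar)
    (mustar : ℝ)
    (hmu : mustar = sInf ((fun x : Fin D → ℝ => Real.sqrt (∑ i, x i ^ 2)) ''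
      {x : Fin D → ℝ | f x = fstar})) :
    ∀ δ : ℝ, 0 < δ →
      ENNReal.ofReal (1 -
          (4 / ((n : ℝ) * ((n : ℝ) + 2) * Real.Gamma ((n : ℝ) / 2))) *
          (1 + ((n : ℝ) / 2) * Real.exp (-(mustar ^ 2) / (2 * δ ^ 2))) *
          (mustar / (Real.sqrt 2 * δ)) ^ n)
        ≤ gaussMatrix D d
            {A | ∃ y : Fin d → ℝ, (∀ i, |y i| ≤ δ) ∧ f (Matrix.mulVec A y) = fstar} := by
  intro δ hδ
  obtain ⟨m, rfl⟩ := Nat.exists_eq_succ_of_ne_zero hde.ne'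
  obtain ⟨x, hx, hxmu, hxmin⟩ :=
    exists_isMinOn_sqrt_sum_sq (s := {x | f x = fstar}) (isClosed_eq hf continuous_const) hatt
  rw [← hmu] at hxmu
  set z := U.transpose.mulVec x
  have hfz : f (U.mulVec z) = fstar := (heff x).symm.trans hx
  have hzmu : √(∑ i, z i ^ 2) = mustar := by
    apply le_antisymm
    · rw [← hxmu]
      exact Real.sqrt_le_sqrt (sum_sq_transpose_mulVec_le hU x)
    · have h3 : ∑ i, U.mulVec z i ^ 2 = ∑ i, z i ^ 2 :=
        sum_sq_transpose_mulVec (V := U.transpose) (by rwa [transpose_transpose]) z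
      rw [← h3, ← hxmu]
      exact hxmin _ hfz
  have hmu0 : 0 ≤ mustar := hzmu ▸ Real.sqrt_nonneg _
  obtain ⟨Q, hQ, hzQ⟩ := exists_orthogonal_matrix_smul_row z
  rw [hzmu] at hzQ
  have hV : (Q * U.transpose) * (Q * U.transpose).transpose = 1 := by
    rw [transpose_mul, transpose_transpose, Matrix.mul_assoc, ← Matrix.mul_assoc U.transpose, hU,
      Matrix.one_mul, hQ]
  have hQz : Q.mulVec z = Pi.single 0 mustar := by
    have : z = Q.transpose.mulVec (Pi.single 0 mustar) := by
      rw [hzQ]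
      ext i
      simp [mul_comm]
    rw [this, mulVec_mulVec, hQ, one_mulVec]
  have hbound := gaussMatrix_solvable_ge (m := m) (d := d) (n := n) (by omega) (by omega) hmu0 hδ
  have heq : (4 / ((n : ℝ) * ((n : ℝ) + 2) * Real.Gamma ((n : ℝ) / 2))) *
          (1 + ((n : ℝ) / 2) * Real.exp (-(mustar ^ 2) / (2 * δ ^ 2))) *
          (mustar / (Real.sqrt 2 * δ)) ^ n = failureBound n (mustar / δ) := by
    rw [failureBound, div_div mustar, mul_comm δ, div_pow mustar δ, div_div, neg_div,
      mul_comm (δ ^ 2)]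
  rw [heq]
  refine hbound.trans ?_
  rw [← map_mul_gaussMatrix d hV]
  rw [Measure.map_apply (by fun_prop) (measurableSet_matrix_solvable m d mustar δ)]
  refine measure_mono fun A hA => ?_
  obtain ⟨y, hy, hy0, hys⟩ := hA
  refine ⟨y, hy, ?_⟩
  have hVA : ∀ i, (Q * U.transpose).mulVec (Matrix.mulVec A y) i =
      (fun k => ∑ j, (Q * U.transpose) i j * A j k) ⬝ᵥ y :=
    mulVec_mulVec_apply _ (of A) y
  generalize Matrix.mulVec A y = w at hVA ⊢
  have hQA : Q.mulVec (U.transpose.mulVec w) = Q.mulVec z := by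
    rw [hQz, mulVec_mulVec]
    ext i
    rw [hVA i]
    refine Fin.cases ?_ (fun j => ?_) i
    · simpa using hy0
    · simpa using hys j
  have hQQ : ∀ u, Q.transpose.mulVec (Q.mulVec u) = u := fun u => by
    rw [mulVec_mulVec, mul_eq_one_comm.1 hQ, one_mulVec]
  have hUA : U.transpose.mulVec w = z := by
    rw [← hQQ (U.transpose.mulVec w), hQA, hQQ]
  rw [heff, hUA, hfz]
end
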